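/- arXiv:2106.06117 — 2 statements merged into one kernel-verified Lean document; each statement's English description precedes it below -/
import Mathlib

section
/- Let X ⊂ ℙ⁵(ℂ) be a smooth hypersurface of degree d ≥ 3 defined by F₁(x₀,x₁,x₂) = F₂(y₀,y₁,y₂), where F₁ ∼ F₂ (equivalent under GL₃(ℂ)), and let ν be the number of d-flex points of the plane curve F₁ = 0. Then the number of 2-dimensional linear subspaces (planes) contained in X is exactly d·ν² + |Aut(F₁)|. -/
open MvPolynomial

noncomputable section

/-- `F(g·x)`: the substitution of a linear change of variables `g` into `F`. -/
def applyMat (g : Matrix (Fin 3) (Fin 3) ℂ) (F : MvPolynomial (Fin 3) ℂ) :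
    MvPolynomial (Fin 3) ℂ :=
  aeval (fun i => ∑ j, C (g i j) * X j) F

/-- The polynomial `F₁(x₀,x₁,x₂) - F₂(y₀,y₁,y₂)` defining the hypersurface `X ⊂ ℙ⁵`. -/
def hyperPoly (F₁ F₂ : MvPolynomial (Fin 3) ℂ) : MvPolynomial (Fin 6) ℂ :=
  rename (![0, 1, 2] : Fin 3 → Fin 6) F₁ - rename (![3, 4, 5] : Fin 3 → Fin 6) F₂

/-- A nonzero vector `p` represents a `d`-flex point of the plane curve `F = 0`:
`p` is on the curve and there is a line through `p` (spanned by `p` and `q`) meeting the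
curve with intersection multiplicity `d` at `p`, i.e. `F(s·p + t·q) = c·t^d`. -/
def IsDFlexRep (d : ℕ) (F : MvPolynomial (Fin 3) ℂ) (p : Fin 3 → ℂ) : Prop :=
  eval p F = 0 ∧
    ∃ q : Fin 3 → ℂ, LinearIndependent ℂ ![p, q] ∧ ∃ c : ℂ, c ≠ 0 ∧
      aeval (fun i => C (p i) * X 0 + C (q i) * X 1) F
        = (C c * X 1 ^ d : MvPolynomial (Fin 2) ℂ)

/-- The number of `d`-flex points of the plane curve `F = 0`, as points of `ℙ²(ℂ)`. -/
def flexCount (d : ℕ) (F : MvPolynomial (Fin 3) ℂ) : ℕ :=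
  {x : Projectivization ℂ (Fin 3 → ℂ) | IsDFlexRep d F x.rep}.ncard

/-- The set of planes (2-dimensional linear subspaces of `ℙ⁵`, i.e. 3-dimensional linear
subspaces of `ℂ⁶`) contained in the hypersurface `P = 0`. -/
def planesIn (P : MvPolynomial (Fin 6) ℂ) : Set (Submodule ℂ (Fin 6 → ℂ)) :=
  {W | Module.finrank ℂ W = 3 ∧ ∀ v ∈ W, eval v P = 0}


lemma deriv_expand {σ : Type} [Fintype σ] (δ : MvPolynomial σ ℂ →ₗ[ℂ] ℂ) (x : σ → ℂ)
    (h1 : ∀ a b, δ (a * b) = eval x a * δ b + eval x b * δ a) (f : MvPolynomial σ ℂ) :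
    δ f = ∑ i, δ (X i) * eval x (pderiv i f) := by
  classical
  have h0 : δ 1 = 0 := by simpa using h1 1 1
  induction f using MvPolynomial.induction_on with
  | C a =>
    have : (C a : MvPolynomial σ ℂ) = a • 1 := by rw [MvPolynomial.smul_eq_C_mul, mul_one]
    rw [this]; simp [h0]
  | add p q hp hq =>
    rw [map_add, hp, hq, ← Finset.sum_add_distrib]
    exact Finset.sum_congr rfl fun i _ => by simp [mul_add]
  | mul_X p n hp =>
    rw [h1, hp]
    simp only [Derivation.leibniz, map_add, smul_eq_mul, map_mul, eval_X, mul_add,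
      Finset.sum_add_distrib, pderiv_X, Finset.mul_sum]
    congr 1
    · rw [Finset.sum_eq_single n]
      · simp [mul_comm]
      · intro b _ hb; simp [hb.symm]
      · simp
    · exact Finset.sum_congr rfl fun i _ => by ring

lemma hasDeriv_eval {σ : Type} [Fintype σ] (F : MvPolynomial σ ℂ) (x v : σ → ℂ) :
    HasDerivAt (fun t : ℂ => eval (x + t • v) F) (∑ i, v i * eval x (pderiv i F)) 0 := by
  classical
  induction F using MvPolynomial.induction_on with
  | C a => simpa using hasDerivAt_const (0:ℂ) a
  | add p q hp hq =>
    simp only [map_add, mul_add, Finset.sum_add_distrib]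
    exact hp.add hq
  | mul_X p n hp =>
    have hX : HasDerivAt (fun t : ℂ => x n + t * v n) (v n) 0 := by
      simpa using ((hasDerivAt_id (0:ℂ)).mul_const (v n)).const_add (x n)
    have := hp.mul hX
    simp only [map_mul, eval_X, Pi.add_apply, Pi.smul_apply, smul_eq_mul]
    convert! this using 1
    simp only [Derivation.leibniz, map_add, smul_eq_mul, map_mul, eval_X, mul_add,
      Finset.sum_add_distrib, pderiv_X, zero_mul, add_zero, zero_smul, Finset.sum_mul]
    rw [add_comm]
    congr 1
    · exact Finset.sum_congr rfl fun i _ => by ring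
    · rw [Finset.sum_eq_single n]
      · simp [mul_comm]
      · intro b _ hb; simp [hb.symm]
      · simp

lemma exists_functional {R M : Type*} [CommRing R] [AddCommGroup M] [Module R M]
    [Module.Finite R M] [Nontrivial M] :
    ∃ m : Ideal R, m.IsMaximal ∧ ∃ φ : M →ₗ[R] (R ⧸ m), φ ≠ 0 := by
  have hann : Module.annihilator R M ≠ ⊤ := by
    intro h
    obtain ⟨x, hx⟩ := exists_ne (0 : M)
    have : (1 : R) ∈ Module.annihilator R M := by rw [h]; trivial
    exact hx (by simpa using Module.mem_annihilator.1 this x)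
  obtain ⟨m, hm, hle⟩ := Ideal.exists_le_maximal _ hann
  refine ⟨m, hm, ?_⟩
  have hne : m • (⊤ : Submodule R M) ≠ ⊤ := by
    intro h
    obtain ⟨r, hr, hr2⟩ := Submodule.exists_sub_one_mem_and_smul_eq_zero_of_fg_of_le_smul m
      (⊤ : Submodule R M) Module.Finite.fg_top h.ge
    have h1 : r ∈ m := hle (Module.mem_annihilator.2 fun n => hr2 n trivial)
    exact hm.ne_top ((Ideal.eq_top_iff_one _).2 (by simpa using m.sub_mem h1 hr))
  let _ : Field (R ⧸ m) := Ideal.Quotient.field m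
  have hnt : Nontrivial (M ⧸ m • (⊤ : Submodule R M)) := Submodule.Quotient.nontrivial_iff.2 hne
  obtain ⟨y, hy⟩ := exists_ne (0 : M ⧸ m • (⊤ : Submodule R M))
  obtain ⟨f, hf⟩ : ∃ f : Module.Dual (R ⧸ m) (M ⧸ m • (⊤ : Submodule R M)), f y ≠ 0 := by
    by_contra! h
    exact hy ((Module.forall_dual_apply_eq_zero_iff (R ⧸ m) y).1 h)
  refine ⟨(f.restrictScalars R).comp (Submodule.mkQ _), fun h => hf ?_⟩
  obtain ⟨z, rfl⟩ := Submodule.mkQ_surjective _ y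
  exact LinearMap.congr_fun h z

lemma fin_of_tangent {σ : Type} [Fintype σ] (S : Set (MvPolynomial σ ℂ))
    (h : ∀ x : σ → ℂ, (∀ f ∈ S, eval x f = 0) → ∀ v : σ → ℂ,
      (∀ f ∈ S, ∑ i, v i * eval x (pderiv i f) = 0) → v = 0) :
    {x : σ → ℂ | ∀ f ∈ S, eval x f = 0}.Finite := by
  set R := MvPolynomial σ ℂ ⧸ Ideal.span S with hR
  have hunr : Algebra.FormallyUnramified ℂ R := by
    rw [Algebra.formallyUnramified_iff]
    by_contra hns
    rw [not_subsingleton_iff_nontrivial] at hns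
    obtain ⟨m, hm, φ, hφ⟩ := exists_functional (R := R) (M := Ω[R⁄ℂ])
    let _ : Field (R ⧸ m) := Ideal.Quotient.field m
    have hfin : Module.Finite ℂ (R ⧸ m) := finite_of_finite_type_of_isJacobsonRing ℂ (R ⧸ m)
    have hbij := IsAlgClosed.algebraMap_bijective_of_isIntegral (k := ℂ) (K := R ⧸ m)
    let e : ℂ ≃ₐ[ℂ] (R ⧸ m) := AlgEquiv.ofBijective (Algebra.ofId ℂ (R ⧸ m)) hbij
    let ψ : MvPolynomial σ ℂ →ₐ[ℂ] ℂ := (e.symm.toAlgHom.comp (Ideal.Quotient.mkₐ ℂ m)).comp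
      (Ideal.Quotient.mkₐ ℂ (Ideal.span S))
    let δ₀ : R →ₗ[ℂ] (R ⧸ m) := (φ.restrictScalars ℂ).comp (KaehlerDifferential.D ℂ R).toLinearMap
    let δ : MvPolynomial σ ℂ →ₗ[ℂ] ℂ := (e.symm.toLinearMap.comp δ₀).comp
      (Ideal.Quotient.mkₐ ℂ (Ideal.span S)).toLinearMap
    let x : σ → ℂ := fun i => ψ (X i)
    have hψ : ∀ f, ψ f = eval x f := by
      intro f
      have : ψ = aeval x := MvPolynomial.algHom_ext fun i => by simp [x]
      rw [this]; simp [MvPolynomial.aeval_eq_eval]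
    have hleib : ∀ a b, δ (a * b) = eval x a * δ b + eval x b * δ a := by
      intro a b
      rw [← hψ, ← hψ]
      have h1 : δ₀ (Ideal.Quotient.mkₐ ℂ (Ideal.span S) (a * b)) =
          Ideal.Quotient.mkₐ ℂ m (Ideal.Quotient.mkₐ ℂ (Ideal.span S) a) *
            δ₀ (Ideal.Quotient.mkₐ ℂ (Ideal.span S) b) +
          Ideal.Quotient.mkₐ ℂ m (Ideal.Quotient.mkₐ ℂ (Ideal.span S) b) *
            δ₀ (Ideal.Quotient.mkₐ ℂ (Ideal.span S) a) := by
        simp only [δ₀, LinearMap.comp_apply, map_mul, Derivation.coeFn_coe, Derivation.leibniz,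
          map_add, LinearMap.coe_restrictScalars, map_smul]
        rfl
      have h2 := congrArg e.symm h1
      rw [map_add e.symm, map_mul e.symm, map_mul e.symm] at h2
      exact h2
    have hexp := deriv_expand δ x hleib
    have hS : ∀ f ∈ S, Ideal.Quotient.mkₐ ℂ (Ideal.span S) f = 0 := fun f hf =>
      Ideal.Quotient.eq_zero_iff_mem.2 (Ideal.subset_span hf)
    have hv : (fun i => δ (X i)) = 0 := by
      apply h x
      · intro f hf
        rw [← hψ]
        change e.symm (Ideal.Quotient.mkₐ ℂ m (Ideal.Quotient.mkₐ ℂ (Ideal.span S) f)) = 0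
        rw [hS f hf]; simp
      · intro f hf
        rw [← hexp]
        change e.symm (δ₀ (Ideal.Quotient.mkₐ ℂ (Ideal.span S) f)) = 0
        rw [hS f hf]; simp
    apply hφ
    have hD : ∀ r : R, φ (KaehlerDifferential.D ℂ R r) = 0 := by
      intro r
      obtain ⟨f, rfl⟩ := Ideal.Quotient.mk_surjective r
      have h2 : δ f = 0 := by
        rw [hexp]; exact Finset.sum_eq_zero fun i _ => by rw [congrFun hv i]; simp
      exact (map_eq_zero_iff e.symm e.symm.injective).1 h2
    have hspan := KaehlerDifferential.span_range_derivation ℂ R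
    refine LinearMap.ext_on hspan ?_
    rintro _ ⟨r, rfl⟩
    simpa using hD r
  have hfin : Module.Finite ℂ R := Algebra.FormallyUnramified.finite_of_free ℂ R
  have hF : Finite (R →ₐ[ℂ] ℂ) := inferInstance
  let T : {x : σ → ℂ | ∀ f ∈ S, eval x f = 0} → (R →ₐ[ℂ] ℂ) := fun x =>
    Ideal.Quotient.liftₐ (Ideal.span S) (aeval x.1) (by
      intro a ha
      have : Ideal.span S ≤ RingHom.ker (aeval x.1 : MvPolynomial σ ℂ →ₐ[ℂ] ℂ) :=
        Ideal.span_le.2 fun f hf => by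
          simpa [RingHom.mem_ker, MvPolynomial.aeval_eq_eval] using x.2 f hf
      exact this ha)
  refine Set.finite_coe_iff.1 (Finite.of_injective T ?_)
  intro x y hxy
  ext i
  have : (aeval x.1 (X i) : ℂ) = aeval y.1 (X i) :=
    AlgHom.congr_fun hxy (Ideal.Quotient.mk _ (X i))
  simpa using this

lemma eval_smul_hom {σ : Type} [Fintype σ] {F : MvPolynomial σ ℂ} {d : ℕ} (hF : F.IsHomogeneous d)
    (c : ℂ) (x : σ → ℂ) : eval (c • x) F = c ^ d * eval x F := by
  rw [MvPolynomial.eval_eq', MvPolynomial.eval_eq', Finset.mul_sum]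
  refine Finset.sum_congr rfl fun m hm => ?_
  have h1 := hF (mem_support_iff.1 hm)
  have h2 : ∑ i, m i = d := by
    rw [← h1, Finsupp.weight_apply, Finsupp.sum_fintype _ _ (by simp)]; simp
  simp only [Pi.smul_apply, smul_eq_mul, mul_pow, Finset.prod_mul_distrib]
  rw [Finset.prod_pow_eq_pow_sum, h2]; ring

/-- directional derivative of `F` at `x` along `v`. -/
def gr (F : MvPolynomial (Fin 3) ℂ) (x v : Fin 3 → ℂ) : ℂ := ∑ i, v i * eval x (pderiv i F)

lemma gr_add (F) (x v w : Fin 3 → ℂ) : gr F x (v + w) = gr F x v + gr F x w := by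
  simp [gr, add_mul, Finset.sum_add_distrib]

lemma gr_smul (F) (x v : Fin 3 → ℂ) (c : ℂ) : gr F x (c • v) = c * gr F x v := by
  simp [gr, Finset.mul_sum, mul_assoc]

lemma gr_hom {F} {d : ℕ} (hF : F.IsHomogeneous d) (x v : Fin 3 → ℂ) (c : ℂ) :
    gr F (c • x) v = c ^ (d - 1) * gr F x v := by
  simp only [gr, Finset.mul_sum]
  refine Finset.sum_congr rfl fun i _ => ?_
  rw [eval_smul_hom hF.pderiv]; ring

lemma gr_eq {F} {x v : Fin 3 → ℂ} {h : ℂ → ℂ} {c : ℂ} (hh : ∀ t : ℂ, eval (x + t • v) F = h t)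
    (hc : HasDerivAt h c 0) : gr F x v = c := by
  have := hasDeriv_eval F x v
  rw [funext hh] at this
  exact this.unique hc

/-- gradient never vanishes off the origin. -/
def Sm (F : MvPolynomial (Fin 3) ℂ) : Prop := ∀ x : Fin 3 → ℂ, x ≠ 0 → ∃ v, gr F x v ≠ 0

lemma hasDerivAt_pow_zero {d : ℕ} (hd : 2 ≤ d) (c : ℂ) :
    HasDerivAt (fun t : ℂ => t ^ d * c) 0 0 := by
  have := (hasDerivAt_pow d (0 : ℂ)).mul_const c
  rw [zero_pow (by omega)] at this
  simpa using this

lemma eval_zero_hom {F} {d : ℕ} (hd : 1 ≤ d) (hF : F.IsHomogeneous d) :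
    eval (0 : Fin 3 → ℂ) F = 0 := by
  have := eval_smul_hom hF 0 (0 : Fin 3 → ℂ)
  rw [zero_pow (by omega)] at this
  simpa using this

lemma no_cone {F} {d : ℕ} (hd : 2 ≤ d) (hF : F.IsHomogeneous d) (hs : Sm F) {p : Fin 3 → ℂ}
    (hp : p ≠ 0) (h : ∀ x, eval (x + p) F = eval x F) : False := by
  obtain ⟨v, hv⟩ := hs p hp
  refine hv (gr_eq (h := fun t => t ^ d * eval v F) (fun t => ?_) (hasDerivAt_pow_zero hd _))
  rw [add_comm, h, eval_smul_hom hF]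

lemma basis3 {p q : Fin 3 → ℂ} (h : LinearIndependent ℂ ![p, q]) :
    ∃ r : Fin 3 → ℂ, ∀ v, ∃ a b c : ℂ, v = a • p + b • q + c • r := by
  have h2 : Module.finrank ℂ (Submodule.span ℂ (Set.range ![p, q])) = 2 := by
    rw [finrank_span_eq_card h]; simp
  have hne : Submodule.span ℂ (Set.range ![p, q]) ≠ ⊤ := by
    intro h; rw [h] at h2; simp at h2
  obtain ⟨r, -, hr⟩ := SetLike.exists_of_lt (lt_top_iff_ne_top.2 hne)
  refine ⟨r, fun v => ?_⟩
  have h3 : LinearIndependent ℂ ![r, p, q] := by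
    exact linearIndependent_finCons.2 ⟨h, hr⟩
  have h4 := h3.span_eq_top_of_card_eq_finrank (by simp)
  have hv : v ∈ Submodule.span ℂ (Set.range ![r, p, q]) := by rw [h4]; trivial
  simp only [Matrix.range_cons, Matrix.range_empty, Set.union_empty, Set.singleton_union] at hv
  obtain ⟨c, w, hw, rfl⟩ := Submodule.mem_span_insert.1 hv
  obtain ⟨a, b, rfl⟩ := Submodule.mem_span_pair.1 hw
  exact ⟨a, b, c, by abel⟩

lemma gr_cont (F) (x v w : Fin 3 → ℂ) : Continuous fun t : ℂ => gr F (x + t • v) w := by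
  unfold gr
  refine continuous_finsetSum _ fun i _ => continuous_const.mul ?_
  exact (MvPolynomial.continuous_eval _).comp (by fun_prop)

lemma eq_of_ne_zero {f g : ℂ → ℂ} (hf : Continuous f) (hg : Continuous g)
    (h : ∀ t, t ≠ 0 → f t = g t) : f 0 = g 0 := by
  have := Continuous.ext_on (dense_compl_singleton (0 : ℂ)) hf hg (fun t ht => h t ht)
  rw [this]

lemma no_line {F} {d : ℕ} (hd : 2 ≤ d) (hF : F.IsHomogeneous d) (hs : Sm F) {p q : Fin 3 → ℂ}
    (hpq : LinearIndependent ℂ ![p, q]) (h : ∀ s t : ℂ, eval (s • p + t • q) F = 0) : False := by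
  obtain ⟨r, hr⟩ := basis3 hpq
  have hp : ∀ s t : ℂ, gr F (s • p + t • q) p = 0 := fun s t =>
    gr_eq (h := fun _ => 0) (fun u => by rw [← h (s + u) t]; congr 2; module) (hasDerivAt_const _ _)
  have hq : ∀ s t : ℂ, gr F (s • p + t • q) q = 0 := fun s t =>
    gr_eq (h := fun _ => 0) (fun u => by rw [← h s (t + u)]; congr 2; module) (hasDerivAt_const _ _)
  have key : ∀ s t : ℂ, (s ≠ 0 ∨ t ≠ 0) → gr F (s • p + t • q) r ≠ 0 := by
    intro s t hst h0
    have hne : s • p + t • q ≠ 0 := by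
      intro h1
      have := LinearIndependent.pair_iff.1 hpq s t h1
      rcases hst with h | h
      · exact h this.1
      · exact h this.2
    obtain ⟨v, hv⟩ := hs _ hne
    obtain ⟨a, b, c, rfl⟩ := hr v
    exact hv (by rw [gr_add, gr_add, gr_smul, gr_smul, gr_smul, hp, hq, h0]; ring)
  let g : Polynomial ℂ := ∑ i, Polynomial.C (r i) *
    aeval (fun j => Polynomial.C (p j) * Polynomial.X + Polynomial.C (q j)) (pderiv i F)
  have hg : ∀ s, g.eval s = gr F (s • p + (1:ℂ) • q) r := by
    intro s
    simp only [g, gr, Polynomial.eval_finsetSum, Polynomial.eval_mul, Polynomial.eval_C]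
    refine Finset.sum_congr rfl fun i _ => ?_
    congr 1
    rw [← Polynomial.coe_evalRingHom, MvPolynomial.aeval_def, MvPolynomial.hom_eval₂,
      ← MvPolynomial.eval₂_id]
    congr 1
    · exact RingHom.ext fun z => by simp
    · ext j
      simp only [Function.comp_apply, Polynomial.coe_evalRingHom, Polynomial.eval_add, Polynomial.eval_mul, Polynomial.eval_C,
        Polynomial.eval_X, Pi.add_apply, Pi.smul_apply, smul_eq_mul]
      ring
  by_cases hdeg : g.degree = 0
  · obtain ⟨c, hc⟩ : ∃ c, g = Polynomial.C c := ⟨_, Polynomial.eq_C_of_degree_eq_zero hdeg⟩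
    have h1 : ∀ t : ℂ, t ≠ 0 → gr F (p + t • q) r = t ^ (d - 1) * c := by
      intro t ht
      have : p + t • q = t • (t⁻¹ • p + (1:ℂ) • q) := by
        rw [smul_add, smul_smul, mul_inv_cancel₀ ht]; simp
      rw [this, gr_hom hF, ← hg, hc]; simp
    have h2 := eq_of_ne_zero (gr_cont F p q r) (by fun_prop) h1
    rw [zero_pow (by omega), zero_mul] at h2
    exact key 1 0 (by simp) (by simpa using h2)
  · obtain ⟨s, hs⟩ := IsAlgClosed.exists_root g hdeg
    exact key s 1 (by simp) (by rw [← hg]; exact hs)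

/-- `F` restricted to the span of `p, a` is `c t^d`. -/
def Fl (d : ℕ) (F : MvPolynomial (Fin 3) ℂ) (p a : Fin 3 → ℂ) (c : ℂ) : Prop :=
  ∀ s t : ℂ, eval (s • p + t • a) F = c * t ^ d

lemma Fl.gr_p {d F p a c} (hd : 2 ≤ d) (h : Fl d F p a c) (s t : ℂ) : gr F (s • p + t • a) p = 0 :=
  gr_eq (h := fun _ => c * t ^ d)
    (fun u => by rw [← h (s + u) t]; congr 2; module) (hasDerivAt_const _ _)

lemma Fl.gr_a {d F p a c} (hd : 2 ≤ d) (h : Fl d F p a c) (s t : ℂ) :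
    gr F (s • p + t • a) a = c * (d * t ^ (d - 1)) :=
  gr_eq (h := fun u => c * (t + u) ^ d)
    (fun u => by rw [← h s (t + u)]; congr 2; module) (by
      have h1 : HasDerivAt (fun u : ℂ => t + u) 1 0 := (hasDerivAt_id (0:ℂ)).const_add t
      simpa using (h1.pow d).const_mul c)

lemma Fl.gr_r {d F p a c} (hd : 2 ≤ d) (hs : Sm F) (h : Fl d F p a c)
    (hpa : LinearIndependent ℂ ![p, a]) {r} (hr : ∀ v, ∃ a' b c : ℂ, v = a' • p + b • a + c • r) :
    gr F p r ≠ 0 := by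
  intro h0
  have hp : p ≠ 0 := by simpa using hpa.ne_zero 0
  obtain ⟨v, hv⟩ := hs p hp
  obtain ⟨x, y, z, rfl⟩ := hr v
  have h1 := h.gr_p hd 1 0
  have h2 := h.gr_a hd 1 0
  rw [zero_pow (by omega)] at h2
  simp only [one_smul, zero_smul, add_zero] at h1 h2
  exact hv (by rw [gr_add, gr_add, gr_smul, gr_smul, gr_smul, h1, h2, h0]; ring)

lemma Fl.unique {d F p a c b c'} (hd : 2 ≤ d) (hs : Sm F) (h : Fl d F p a c)
    (hpa : LinearIndependent ℂ ![p, a]) (h' : Fl d F p b c') : ∃ x y : ℂ, b = x • p + y • a := by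
  obtain ⟨r, hr⟩ := basis3 hpa
  have h3 := h.gr_r hd hs hpa hr
  obtain ⟨x, y, z, rfl⟩ := hr b
  have h1 := h.gr_p hd 1 0
  have h2 := h.gr_a hd 1 0
  have h4 := h'.gr_a hd 1 0
  rw [zero_pow (by omega)] at h2 h4
  simp only [one_smul, zero_smul, add_zero] at h1 h2 h4
  rw [gr_add, gr_add, gr_smul, gr_smul, gr_smul, h1, h2] at h4
  have : z = 0 := by simpa [h3] using h4
  exact ⟨x, y, by simp [this]⟩

lemma flex_tangent {d F p a} (hd : 3 ≤ d) (hs : Sm F) (h : Fl d F p a 1)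
    (hpa : LinearIndependent ℂ ![p, a]) {p' a' : Fin 3 → ℂ}
    (ht : ∀ s t : ℂ, gr F (s • p + t • a) (s • p' + t • a') = 0) :
    (∃ x : ℂ, p' = x • p) ∧ ∃ x : ℂ, a' = x • p := by
  obtain ⟨r, hr⟩ := basis3 hpa
  have h3 := h.gr_r (by omega) hs hpa hr
  obtain ⟨x0, x1, x2, rfl⟩ := hr p'
  obtain ⟨y0, y1, y2, rfl⟩ := hr a'
  have e : ∀ t : ℂ, d * t ^ (d - 1) * (x1 + t * y1) + gr F (p + t • a) r * (x2 + t * y2) = 0 := by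
    intro t
    have h1 := h.gr_p (by omega) 1 t
    have h2 := h.gr_a (by omega) 1 t
    have h4 := ht 1 t
    simp only [one_smul] at h1 h2 h4
    simp only [gr_add, gr_smul, h1, h2] at h4
    linear_combination h4
  have hx2 : x2 = 0 := by
    have := e 0
    rw [zero_pow (by omega)] at this
    simpa [h3] using this
  subst hx2
  have e2 : ∀ t : ℂ, t ≠ 0 → d * t ^ (d - 2) * (x1 + t * y1) + gr F (p + t • a) r * y2 = 0 := by
    intro t ht
    have := e t
    have h5 : t ^ (d - 1) = t * t ^ (d - 2) := by rw [← pow_succ']; congr 1; omega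
    rw [h5] at this
    apply mul_left_cancel₀ ht
    linear_combination this
  have hc := gr_cont F p a r
  have hy2 : y2 = 0 := by
    have := eq_of_ne_zero (by fun_prop) (by fun_prop) e2
    rw [zero_pow (by omega)] at this
    simpa [h3] using this
  subst hy2
  have e3 : ∀ t : ℂ, t ≠ 0 → x1 + t * y1 = 0 := by
    intro t ht
    have := e2 t ht
    have hd0 : (d : ℂ) ≠ 0 := by norm_cast; omega
    simpa [ht, hd0] using this
  have a1 := e3 1 (by simp)
  have a2 := e3 2 (by simp)
  have hy1 : y1 = 0 := by linear_combination a2 - a1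
  have hx1 : x1 = 0 := by linear_combination 2 * a1 - a2
  subst hy1 hx1
  exact ⟨⟨x0, by simp⟩, ⟨y0, by simp⟩⟩

lemma eval_aeval {σ τ : Type} (F : MvPolynomial σ ℂ) (g : σ → MvPolynomial τ ℂ) (x : τ → ℂ) :
    eval x (aeval g F) = eval (fun i => eval x (g i)) F := by
  induction F using MvPolynomial.induction_on with
  | C a => simp
  | add p q hp hq => simp only [map_add, hp, hq]
  | mul_X p n hp => rw [map_mul, map_mul, hp, aeval_X, map_mul, eval_X]

lemma isDFlex_iff {d : ℕ} (hd : 2 ≤ d) (F : MvPolynomial (Fin 3) ℂ) (p : Fin 3 → ℂ) :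
    IsDFlexRep d F p ↔ ∃ a, LinearIndependent ℂ ![p, a] ∧ Fl d F p a 1 := by
  constructor
  · rintro ⟨-, q, hq, c, hc, h⟩
    obtain ⟨z, hz⟩ := IsAlgClosed.exists_pow_nat_eq (c⁻¹) (n := d) (by omega)
    have hz0 : z ≠ 0 := by
      rintro rfl; rw [zero_pow (by omega)] at hz; exact inv_ne_zero hc hz.symm
    refine ⟨z • q, ?_, fun s t => ?_⟩
    · rw [LinearIndependent.pair_iff] at hq ⊢
      intro s t hst
      have := hq s (t * z) (by rw [← hst]; module)
      exact ⟨this.1, by simpa [hz0] using this.2⟩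
    · have := congrArg (eval ![s, t * z]) h
      rw [eval_aeval] at this
      simp only [map_add, map_mul, eval_C, eval_X, map_pow, Matrix.cons_val_zero,
        Matrix.cons_val_one] at this
      rw [mul_pow, hz] at this
      have e : (fun i => p i * s + q i * (t * z)) = s • p + t • z • q := by
        ext i; simp only [Pi.add_apply, Pi.smul_apply, smul_eq_mul]; ring
      rw [e] at this
      rw [this]; field_simp
  · rintro ⟨a, ha, h⟩
    refine ⟨?_, a, ha, 1, one_ne_zero, ?_⟩
    · have := h 1 0
      rw [zero_pow (by omega)] at this
      simpa using this
    · refine MvPolynomial.funext fun x => ?_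
      rw [eval_aeval]
      have := h (x 0) (x 1)
      simp only [map_add, map_mul, eval_C, eval_X, map_pow]
      rw [← this]
      congr 2
      ext i; simp only [Pi.add_apply, Pi.smul_apply, smul_eq_mul]; ring

/-- equations of the chart of the flex variety. -/
def flexEq (d : ℕ) (F : MvPolynomial (Fin 3) ℂ) (i : Fin 3) :
    Set (MvPolynomial (Fin 3 ⊕ Fin 3) ℂ) :=
  {X (Sum.inl i) - 1, X (Sum.inr i)} ∪ Set.range fun st : ℂ × ℂ =>
    aeval (fun j => C st.1 * X (Sum.inl j) + C st.2 * X (Sum.inr j)) F - C (st.2 ^ d)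

lemma flexEq_eval (d : ℕ) (F : MvPolynomial (Fin 3) ℂ) (s t : ℂ) (x : Fin 3 ⊕ Fin 3 → ℂ) :
    eval x (aeval (fun j => C s * X (Sum.inl j) + C t * X (Sum.inr j)) F - C (t ^ d)) =
    eval (s • (x ∘ Sum.inl) + t • (x ∘ Sum.inr)) F - t ^ d := by
  rw [map_sub, eval_aeval, eval_C]
  congr 3
  ext i; simp

lemma flexEq_finite {d : ℕ} (hd : 3 ≤ d) {F : MvPolynomial (Fin 3) ℂ} (hs : Sm F) (i : Fin 3) :
    {x : Fin 3 ⊕ Fin 3 → ℂ | ∀ f ∈ flexEq d F i, eval x f = 0}.Finite := by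
  apply fin_of_tangent
  intro x hx v hv
  have hp : x (Sum.inl i) = 1 := by
    have := hx (X (Sum.inl i) - 1) (by simp [flexEq])
    simpa [sub_eq_zero] using this
  have ha : x (Sum.inr i) = 0 := by
    have := hx (X (Sum.inr i)) (by simp [flexEq])
    simpa using this
  have hp' : v (Sum.inl i) = 0 := by
    have := hv (X (Sum.inl i) - 1) (by simp [flexEq])
    have h2 := hasDeriv_eval (X (Sum.inl i) - 1) x v
    rw [this] at h2
    have h3 : HasDerivAt (fun t : ℂ => x (Sum.inl i) + t * v (Sum.inl i) - 1) (v (Sum.inl i)) 0 := by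
      simpa using (((hasDerivAt_id (0:ℂ)).mul_const (v (Sum.inl i))).const_add (x (Sum.inl i))).sub_const 1
    simp only [map_sub, eval_X, map_one, Pi.add_apply, Pi.smul_apply, smul_eq_mul] at h2
    exact h3.unique h2
  have ha' : v (Sum.inr i) = 0 := by
    have := hv (X (Sum.inr i)) (by simp [flexEq])
    have h2 := hasDeriv_eval (X (Sum.inr i)) x v
    rw [this] at h2
    have h3 : HasDerivAt (fun t : ℂ => x (Sum.inr i) + t * v (Sum.inr i)) (v (Sum.inr i)) 0 := by
      simpa using (((hasDerivAt_id (0:ℂ)).mul_const (v (Sum.inr i))).const_add (x (Sum.inr i)))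
    simp only [eval_X, Pi.add_apply, Pi.smul_apply, smul_eq_mul] at h2
    exact h3.unique h2
  have hFl : Fl d F (x ∘ Sum.inl) (x ∘ Sum.inr) 1 := by
    intro s t
    have := hx _ (Or.inr ⟨(s, t), rfl⟩)
    rw [flexEq_eval] at this
    rw [one_mul]
    exact sub_eq_zero.1 this
  have hp0 : x ∘ Sum.inl ≠ 0 := fun h => by
    have := congrFun h i
    simp [hp] at this
  have hLI : LinearIndependent ℂ ![x ∘ Sum.inl, x ∘ Sum.inr] := by
    rw [LinearIndependent.pair_iff]
    intro s t hst
    have h1 := hFl s t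
    have h0 := hFl 0 0
    rw [zero_pow (by omega)] at h0
    rw [hst] at h1
    simp only [zero_smul, add_zero, mul_zero] at h0
    rw [h0, one_mul] at h1
    have ht : t = 0 := pow_eq_zero_iff (by omega) |>.1 h1.symm
    subst ht
    simp only [zero_smul, add_zero, smul_eq_zero, hp0, or_false] at hst
    exact ⟨hst, rfl⟩
  have ht : ∀ s t : ℂ, gr F (s • (x ∘ Sum.inl) + t • (x ∘ Sum.inr))
      (s • (v ∘ Sum.inl) + t • (v ∘ Sum.inr)) = 0 := by
    intro s t
    have h1 := hv _ (Or.inr ⟨(s, t), rfl⟩)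
    have h2 := hasDeriv_eval (aeval (fun j => C s * X (Sum.inl j) + C t * X (Sum.inr j)) F
      - C (t ^ d)) x v
    rw [h1] at h2
    refine gr_eq (fun u => ?_) (h2.add_const (t ^ d))
    rw [flexEq_eval, sub_add_cancel]
    congr 2
    ext j; simp; ring
  obtain ⟨⟨c, hc⟩, ⟨c', hc'⟩⟩ := flex_tangent hd hs hFl hLI ht
  have e1 := congrFun hc i
  have e2 := congrFun hc' i
  simp [hp, hp', ha'] at e1 e2
  subst e1 e2
  ext j
  rcases j with j | j
  · simpa using congrFun hc j
  · simpa using congrFun hc' j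

lemma flex_finite {d : ℕ} (hd : 3 ≤ d) {F : MvPolynomial (Fin 3) ℂ} (hs : Sm F) :
    {x : Projectivization ℂ (Fin 3 → ℂ) | IsDFlexRep d F x.rep}.Finite := by
  refine Set.Finite.of_finite_image (f := Projectivization.submodule) ?_
    (Projectivization.submodule_injective.injOn)
  refine Set.Finite.subset (Set.finite_iUnion fun i => (flexEq_finite hd hs i).image
    (fun x => Submodule.span ℂ {x ∘ Sum.inl})) ?_
  rintro _ ⟨x, hx, rfl⟩
  obtain ⟨a, -, h⟩ := (isDFlex_iff (by omega) _ _).1 hx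
  obtain ⟨i, hi⟩ := Function.ne_iff.1 x.rep_nonzero
  simp only [Pi.zero_apply] at hi
  refine Set.mem_iUnion.2 ⟨i, Sum.elim ((x.rep i)⁻¹ • x.rep) (a - (a i * (x.rep i)⁻¹) • x.rep), ?_, ?_⟩
  · rintro f ((rfl | rfl) | ⟨⟨s, t⟩, rfl⟩)
    · simp [hi]
    · simp [hi]
    · rw [flexEq_eval, sub_eq_zero, Sum.elim_comp_inl, Sum.elim_comp_inr]
      have := h (s * (x.rep i)⁻¹ - t * (a i * (x.rep i)⁻¹)) t
      rw [one_mul] at this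
      rw [← this]; congr 2; module
  · rw [Projectivization.submodule_eq]
    simp only [Sum.elim_comp_inl]
    exact Submodule.span_singleton_smul_eq (IsUnit.mk0 _ (inv_ne_zero hi)) _

lemma hasDeriv_curve (F : MvPolynomial (Fin 3) ℂ) (γ : ℂ → Fin 3 → ℂ) (v : Fin 3 → ℂ) (t : ℂ)
    (hγ : ∀ i, HasDerivAt (fun u => γ u i) (v i) t) :
    HasDerivAt (fun u : ℂ => eval (γ u) F) (gr F (γ t) v) t := by
  classical
  unfold gr
  induction F using MvPolynomial.induction_on with
  | C a => simpa using hasDerivAt_const t a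
  | add p q hp hq =>
    simp only [map_add, mul_add, Finset.sum_add_distrib]
    exact hp.add hq
  | mul_X p n hp =>
    have := hp.mul (hγ n)
    simp only [map_mul, eval_X]
    convert! this using 1
    simp only [Derivation.leibniz, map_add, smul_eq_mul, map_mul, eval_X, mul_add,
      Finset.sum_add_distrib, pderiv_X, Finset.sum_mul]
    rw [add_comm]
    congr 1
    · exact Finset.sum_congr rfl fun i _ => by ring
    · rw [Finset.sum_eq_single n]
      · simp [mul_comm]
      · intro b _ hb; simp [hb.symm]
      · simp

lemma gr_inv {F : MvPolynomial (Fin 3) ℂ} {g : (Fin 3 → ℂ) →ₗ[ℂ] (Fin 3 → ℂ)}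
    (hg : ∀ x, eval (g x) F = eval x F) (x w : Fin 3 → ℂ) : gr F (g x) (g w) = gr F x w :=
  gr_eq (h := fun u => eval (x + u • w) F) (fun u => by rw [← hg (x + u • w), map_add, map_smul]) (hasDeriv_eval F x w)

lemma grad_lower {F : MvPolynomial (Fin 3) ℂ} {d : ℕ} (hF : F.IsHomogeneous d) (hs : Sm F) :
    ∃ c : ℝ, 0 < c ∧ ∀ x : Fin 3 → ℂ, x ≠ 0 →
      c * ‖x‖ ^ (d - 1) ≤ ‖fun i => eval x (pderiv i F)‖ := by
  have hcont : Continuous fun x : Fin 3 → ℂ => ‖fun i => eval x (pderiv i F)‖ :=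
    continuous_norm.comp (continuous_pi fun i => MvPolynomial.continuous_eval _)
  obtain ⟨x₀, hx₀, hmin⟩ := (isCompact_sphere (0 : Fin 3 → ℂ) 1).exists_isMinOn
    (NormedSpace.sphere_nonempty.2 zero_le_one) hcont.continuousOn
  have hx0 : x₀ ≠ 0 := by
    rintro rfl; simp at hx₀
  refine ⟨_, (norm_pos_iff (a := fun i => eval x₀ (pderiv i F))).2 ?_, fun x hx => ?_⟩
  · intro h
    obtain ⟨v, hv⟩ := hs x₀ hx0
    exact hv (Finset.sum_eq_zero fun i _ => by
      have : eval x₀ (pderiv i F) = 0 := congrFun h i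
      rw [this, mul_zero])
  · have hn : ‖x‖ ≠ 0 := norm_ne_zero_iff.2 hx
    have h1 : ((‖x‖ : ℂ)⁻¹ • x) ∈ Metric.sphere (0 : Fin 3 → ℂ) 1 := by
      simp [norm_smul, hn]
    have h2 := hmin h1
    simp only [Set.mem_ofPred_eq] at h2
    have h3 : (fun i => eval x (pderiv i F)) = ((‖x‖ : ℂ) ^ (d - 1)) •
        fun i => eval ((‖x‖ : ℂ)⁻¹ • x) (pderiv i F) := by
      ext i
      rw [Pi.smul_apply, smul_eq_mul, ← eval_smul_hom hF.pderiv, smul_smul, mul_inv_cancel₀ (by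
        exact_mod_cast hn), one_smul]
    rw [h3, norm_smul, norm_pow, Complex.norm_real, norm_norm, mul_comm]
    gcongr

lemma gr_bound (F : MvPolynomial (Fin 3) ℂ) (x w : Fin 3 → ℂ) :
    ‖gr F x w‖ ≤ 3 * ‖w‖ * ‖fun i => eval x (pderiv i F)‖ := by
  unfold gr
  refine (norm_sum_le _ _).trans ?_
  have : ∀ i ∈ (Finset.univ : Finset (Fin 3)), ‖w i * eval x (pderiv i F)‖ ≤
      ‖w‖ * ‖fun i => eval x (pderiv i F)‖ := by
    intro i _
    rw [norm_mul]
    exact mul_le_mul (norm_le_pi_norm w i) (norm_le_pi_norm (fun i => eval x (pderiv i F)) i)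
      (norm_nonneg _) (norm_nonneg _)
  refine (Finset.sum_le_sum this).trans ?_
  simp; ring_nf; rfl

lemma aut_bound {F : MvPolynomial (Fin 3) ℂ} {d : ℕ} (hd : 3 ≤ d) (hF : F.IsHomogeneous d)
    (hs : Sm F) : ∃ M : ℝ, ∀ g g' : (Fin 3 → ℂ) →ₗ[ℂ] (Fin 3 → ℂ), (∀ x, g (g' x) = x) →
      (∀ x, g' (g x) = x) →
      (∀ x, eval (g x) F = eval x F) → ∀ j, ‖g (Pi.single j 1)‖ ≤ M := by
  obtain ⟨c, hc, hlow⟩ := grad_lower hF hs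
  set C : ℝ := ‖fun j : Fin 3 => fun i => eval (Pi.single j 1) (pderiv i F)‖ with hC
  have half : ∀ g g' : (Fin 3 → ℂ) →ₗ[ℂ] (Fin 3 → ℂ), (∀ x, g (g' x) = x) → (∀ x, g' (g x) = x) →
      (∀ x, eval (g x) F = eval x F) →
      ‖fun j : Fin 3 => g (Pi.single j 1)‖ ^ (d - 1) ≤
        (3 * C / c) * ‖fun j : Fin 3 => g' (Pi.single j 1)‖ := by
    intro g g' hgg' hg'g hg
    obtain ⟨j, hj⟩ := Finite.exists_max fun j : Fin 3 => ‖g (Pi.single j 1)‖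
    have hnj : ‖fun j : Fin 3 => g (Pi.single j 1)‖ ≤ ‖g (Pi.single j 1)‖ :=
      (pi_norm_le_iff_of_nonneg (norm_nonneg _)).2 hj
    have hne : g (Pi.single j 1) ≠ 0 := by
      intro h
      have := congrArg g' h
      rw [hg'g, map_zero] at this
      simpa using congrFun this j
    have h1 := hlow _ hne
    have h2 : ‖fun i => eval (g (Pi.single j 1)) (pderiv i F)‖ ≤
        3 * ‖fun j : Fin 3 => g' (Pi.single j 1)‖ * C := by
      refine (pi_norm_le_iff_of_nonneg (by positivity)).2 fun i => ?_
      have h3 : eval (g (Pi.single j 1)) (pderiv i F) =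
          gr F (Pi.single j 1) (g' (Pi.single i 1)) := by
        rw [← gr_inv hg, hgg']
        simp [gr, Pi.single_apply]
      rw [h3]
      refine (gr_bound _ _ _).trans ?_
      gcongr
      · exact norm_le_pi_norm (fun j : Fin 3 => g' (Pi.single j 1)) i
      · exact norm_le_pi_norm (fun j : Fin 3 => fun i => eval (Pi.single j 1) (pderiv i F)) j
    have h4 : ‖fun j : Fin 3 => g (Pi.single j 1)‖ ^ (d - 1) ≤ ‖g (Pi.single j 1)‖ ^ (d - 1) := by
      gcongr
    rw [div_mul_eq_mul_div, le_div_iff₀ hc]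
    nlinarith [mul_le_mul_of_nonneg_left h4 hc.le]
  set M := 3 * C / c
  refine ⟨max 1 M, fun g g' h1 h2 hg j => ?_⟩
  have a1 := half g g' h1 h2 hg
  have a2 := half g' g h2 h1 (fun x => by rw [← hg, h1])
  refine (norm_le_pi_norm (fun j : Fin 3 => g (Pi.single j 1)) j).trans ?_
  set a := ‖fun j : Fin 3 => g (Pi.single j 1)‖
  set b := ‖fun j : Fin 3 => g' (Pi.single j 1)‖
  have hM : 0 ≤ M := by positivity
  have hm : max a b ^ (d - 1) ≤ M * max a b := by
    rcases le_total a b with h | h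
    · rw [max_eq_right h]; exact a2.trans (by gcongr)
    · rw [max_eq_left h]; exact a1.trans (by gcongr)
  refine (le_max_left a b).trans ?_
  by_contra! hlt
  have g1 : 1 < max a b := (le_max_left _ _).trans_lt hlt
  have g2 : M < max a b := (le_max_right _ _).trans_lt hlt
  have g3 : max a b ^ 2 ≤ max a b ^ (d - 1) := pow_le_pow_right₀ g1.le (by omega)
  nlinarith

lemma exists_exp {𝔸 : Type*} [NormedRing 𝔸] [NormedAlgebra ℂ 𝔸] [CompleteSpace 𝔸] (A : 𝔸) :
    ∃ E : ℂ → 𝔸, E 0 = 1 ∧ (∀ t, HasDerivAt E (A * E t) t) ∧ ∀ t, E t * E (-t) = 1 := by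
  refine ⟨fun t => NormedSpace.exp (t • A), by simp, fun t => hasDerivAt_exp_smul_const' A t,
    fun t => ?_⟩
  let _ : NormedAlgebra ℚ 𝔸 := NormedAlgebra.restrictScalars ℚ ℂ _
  have hcomm : Commute (t • A) ((-t) • A) := ((Commute.refl A).smul_left t).smul_right (-t)
  rw [← NormedSpace.exp_add_of_commute hcomm, ← add_smul, add_neg_cancel, zero_smul,
    NormedSpace.exp_zero]

lemma aut_lie {F : MvPolynomial (Fin 3) ℂ} {d : ℕ} (hd : 3 ≤ d) (hF : F.IsHomogeneous d)
    (hs : Sm F) (A : (Fin 3 → ℂ) →L[ℂ] (Fin 3 → ℂ)) (hA : ∀ x, gr F x (A x) = 0) : A = 0 := by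
  obtain ⟨M, hM⟩ := aut_bound hd hF hs
  obtain ⟨E, hE0, hE, hEm⟩ := exists_exp A
  have hEx : ∀ x t, HasDerivAt (fun t => E t x) (A (E t x)) t := fun x t => by
    have := (ContinuousLinearMap.apply ℂ (Fin 3 → ℂ) x).hasFDerivAt.comp_hasDerivAt t (hE t)
    exact this
  have hinv : ∀ t x, eval (E t x) F = eval x F := by
    intro t x
    have hder : ∀ t, HasDerivAt (fun u => eval (E u x) F) 0 t := by
      intro t
      have := hasDeriv_curve F (fun u => E u x) (A (E t x)) t (hasDerivAt_pi.1 (hEx x t))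
      rwa [hA] at this
    have := is_const_of_deriv_eq_zero (fun t => (hder t).differentiableAt)
      (fun t => (hder t).deriv) t 0
    simpa [hE0] using this
  have hmul : ∀ t x, E t (E (-t) x) = x := by
    intro t x
    exact congrArg (fun f => f x) (hEm t)
  have hbd : ∀ j t, ‖E t (Pi.single j 1)‖ ≤ M := fun j t =>
    hM (E t).toLinearMap (E (-t)).toLinearMap (hmul t) (fun x => by
      have := hmul (-t) x
      rwa [neg_neg] at this) (hinv t) j
  have hAj : ∀ j, A (Pi.single j 1) = 0 := by
    intro j
    have hdiff : Differentiable ℂ fun t => E t (Pi.single j 1) := fun t =>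
      (hEx _ t).differentiableAt
    have hb : Bornology.IsBounded (Set.range fun t => E t (Pi.single j 1)) := by
      rw [isBounded_iff_forall_norm_le]
      exact ⟨M, by rintro _ ⟨t, rfl⟩; exact hbd j t⟩
    have hconst : (fun t => E t (Pi.single j 1)) = fun _ => E 0 (Pi.single j 1) :=
      funext fun t => hdiff.apply_eq_apply_of_bounded hb t 0
    have h1 := hEx (Pi.single j 1) 0
    rw [hconst] at h1
    have := h1.unique (hasDerivAt_const _ _)
    simpa [hE0] using this
  apply ContinuousLinearMap.coe_injective
  refine LinearMap.pi_ext' fun j => LinearMap.ext_ring ?_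
  simpa using hAj j

lemma applyMat_iff (g : Matrix (Fin 3) (Fin 3) ℂ) (F G : MvPolynomial (Fin 3) ℂ) :
    applyMat g F = G ↔ ∀ x, eval (g.mulVec x) F = eval x G := by
  have key : ∀ x, eval x (applyMat g F) = eval (g.mulVec x) F := by
    intro x
    rw [applyMat, eval_aeval]
    congr 2
    ext i; simp [Matrix.mulVec, dotProduct]
  constructor
  · rintro rfl x; exact (key x).symm
  · intro h; exact MvPolynomial.funext fun x => by rw [key, h]

lemma autEq_eval (F : MvPolynomial (Fin 3) ℂ) (x : Fin 3 → ℂ) (g : Fin 3 × Fin 3 → ℂ) :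
    eval g (aeval (fun i => ∑ j, C (x j) * X (i, j)) F - C (eval x F)) =
      eval ((Matrix.of fun i j => g (i, j)).mulVec x) F - eval x F := by
  rw [map_sub, eval_aeval, eval_C]
  congr 3
  ext i; simp [Matrix.mulVec, dotProduct, mul_comm]

lemma autMat_finite {F : MvPolynomial (Fin 3) ℂ} {d : ℕ} (hd : 3 ≤ d) (hF : F.IsHomogeneous d)
    (hs : Sm F) : {g : Matrix (Fin 3) (Fin 3) ℂ | applyMat g F = F}.Finite := by
  have hfin : {g : Fin 3 × Fin 3 → ℂ | ∀ f ∈ Set.range (fun x : Fin 3 → ℂ =>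
      aeval (fun i => ∑ j, C (x j) * X (i, j)) F - C (eval x F)), eval g f = 0}.Finite := by
    apply fin_of_tangent
    intro g hg v hv
    set G := (Matrix.of fun i j => g (i, j)).mulVecLin with hGdef
    set B := (Matrix.of fun i j => v (i, j)).mulVecLin with hBdef
    have hG : ∀ x, eval (G x) F = eval x F := by
      intro x
      have := hg _ ⟨x, rfl⟩
      simp only [autEq_eval] at this
      exact sub_eq_zero.1 this
    have hB : ∀ x, gr F (G x) (B x) = 0 := by
      intro x
      have h1 := hv _ ⟨x, rfl⟩
      have h2 := hasDeriv_eval (aeval (fun i => ∑ j, C (x j) * X (i, j)) F - C (eval x F)) g v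
      simp only at h1
      rw [h1] at h2
      refine gr_eq (fun u => ?_) (h2.add_const (eval x F))
      rw [autEq_eval, sub_add_cancel]
      congr 2
      ext i
      simp [hGdef, hBdef, Matrix.mulVec, dotProduct, add_mul, Finset.sum_add_distrib,
        Finset.mul_sum, mul_assoc]
    have hinj : Function.Injective G := by
      rw [injective_iff_map_eq_zero]
      intro p hp
      by_contra hne
      exact no_cone (by omega) hF hs hne fun x => by rw [← hG, map_add, hp, add_zero, hG]
    let e := LinearEquiv.ofInjectiveEndo G hinj
    have he : ∀ x, G (e.symm x) = x := fun x => e.apply_symm_apply x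
    have hA := aut_lie hd hF hs (B.comp e.symm.toLinearMap).toContinuousLinearMap (fun x => by
      have := hB (e.symm x)
      rw [he] at this
      exact this)
    have hB0 : ∀ x, B x = 0 := by
      intro x
      have : (B.comp e.symm.toLinearMap).toContinuousLinearMap (e x) = 0 := by rw [hA]; rfl
      simpa using this
    ext ⟨i, j⟩
    have := congrFun (hB0 (Pi.single j 1)) i
    simpa [hBdef] using this
  refine (hfin.image fun g => Matrix.of fun i j => g (i, j)).subset ?_
  intro g hg
  refine ⟨fun ij => g ij.1 ij.2, ?_, rfl⟩
  rintro _ ⟨x, rfl⟩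
  simp only [autEq_eval]
  exact sub_eq_zero.2 ((applyMat_iff g F F).1 hg x)

/-- planes in `F(x) = F(y)`. -/
def PL (F : MvPolynomial (Fin 3) ℂ) : Set (Submodule ℂ ((Fin 3 → ℂ) × (Fin 3 → ℂ))) :=
  {W | Module.finrank ℂ W = 3 ∧ ∀ w ∈ W, eval w.1 F = eval w.2 F}

lemma hyper_eval (F₁ F₂ : MvPolynomial (Fin 3) ℂ) (v : Fin 6 → ℂ) :
    eval v (hyperPoly F₁ F₂) = eval (v ∘ ![0, 1, 2]) F₁ - eval (v ∘ ![3, 4, 5]) F₂ := by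
  rw [hyperPoly, map_sub, eval_rename, eval_rename]

lemma sm_of_hyper {d : ℕ} (hd : 3 ≤ d) {F₁ F₂ : MvPolynomial (Fin 3) ℂ}
    (hF₁ : F₁.IsHomogeneous d) (hF₂ : F₂.IsHomogeneous d)
    (hsmooth : ∀ v : Fin 6 → ℂ, v ≠ 0 →
      ¬ (eval v (hyperPoly F₁ F₂) = 0 ∧ ∀ i, eval v (pderiv i (hyperPoly F₁ F₂)) = 0)) :
    Sm F₁ := by
  intro x hx
  by_contra! h
  set v : Fin 6 → ℂ := ![x 0, x 1, x 2, 0, 0, 0] with hv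
  have h1 : v ∘ ![0, 1, 2] = x := by ext i; fin_cases i <;> rfl
  have h2 : v ∘ ![3, 4, 5] = 0 := by ext i; fin_cases i <;> rfl
  have hv0 : v ≠ 0 := by
    intro h0; apply hx; rw [← h1, h0]; rfl
  refine hsmooth v hv0 ⟨?_, fun i => ?_⟩
  · rw [hyper_eval, h1, h2, eval_zero_hom (by omega) hF₂, sub_zero]
    have hE := congrArg (eval x) hF₁.sum_X_mul_pderiv
    have hz : eval x (∑ i, X i * pderiv i F₁) = 0 := by
      rw [map_sum, ← h x]; simp [gr]
    rw [hz] at hE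
    have hd0 : (d : ℂ) ≠ 0 := by norm_cast; omega
    simpa [hd0] using hE.symm
  · have e1 := hasDeriv_eval (hyperPoly F₁ F₂) v (Pi.single i 1)
    have e2 := hasDeriv_eval F₁ x ((Pi.single i 1 : Fin 6 → ℂ) ∘ ![0, 1, 2])
    have e3 := hasDeriv_eval F₂ 0 ((Pi.single i 1 : Fin 6 → ℂ) ∘ ![3, 4, 5])
    have g2 : gr F₁ x ((Pi.single i 1 : Fin 6 → ℂ) ∘ ![0, 1, 2]) = 0 := h _
    have g3 : gr F₂ 0 ((Pi.single i 1 : Fin 6 → ℂ) ∘ ![3, 4, 5]) = 0 := by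
      have := gr_hom hF₂ 0 ((Pi.single i 1 : Fin 6 → ℂ) ∘ ![3, 4, 5]) 0
      rw [zero_pow (by omega)] at this
      simpa using this
    rw [gr] at g2 g3
    rw [g2] at e2
    rw [g3] at e3
    have e4 := e2.sub e3
    have e5 : (fun t : ℂ => eval (v + t • (Pi.single i 1 : Fin 6 → ℂ)) (hyperPoly F₁ F₂)) =
      (fun t : ℂ => eval (x + t • ((Pi.single i 1 : Fin 6 → ℂ) ∘ ![0, 1, 2])) F₁) -
      (fun t : ℂ => eval (0 + t • ((Pi.single i 1 : Fin 6 → ℂ) ∘ ![3, 4, 5])) F₂) := by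
      ext t
      rw [hyper_eval, Pi.sub_apply]
      nth_rewrite 1 [← h1]
      rw [← h2]
      rfl
    rw [e5] at e1
    have := e1.unique e4
    simpa [Pi.single_apply] using this

lemma planes_ncard {F₁ F₂ : MvPolynomial (Fin 3) ℂ} (g : Matrix (Fin 3) (Fin 3) ℂ)
    (hg : IsUnit g.det) (h : applyMat g F₁ = F₂) :
    (planesIn (hyperPoly F₁ F₂)).ncard = (PL F₁).ncard := by
  let f : (Fin 6 → ℂ) →ₗ[ℂ] (Fin 3 → ℂ) × (Fin 3 → ℂ) :=
    LinearMap.prod (LinearMap.funLeft ℂ ℂ ![0, 1, 2])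
      (g.mulVecLin.comp (LinearMap.funLeft ℂ ℂ ![3, 4, 5]))
  have hf : ∀ v, f v = (v ∘ ![0, 1, 2], g.mulVec (v ∘ ![3, 4, 5])) := fun v => rfl
  have hinj : Function.Injective f := by
    rw [injective_iff_map_eq_zero]
    intro v hv
    rw [hf, Prod.mk_eq_zero] at hv
    have h2 : v ∘ ![3, 4, 5] = 0 := by
      have := (Matrix.mulVec_injective_iff_isUnit.2 ((Matrix.isUnit_iff_isUnit_det g).2 hg))
      exact this (by rw [hv.2, Matrix.mulVec_zero])
    ext i
    fin_cases i
    · exact congrFun hv.1 0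
    · exact congrFun hv.1 1
    · exact congrFun hv.1 2
    · exact congrFun h2 0
    · exact congrFun h2 1
    · exact congrFun h2 2
  let e := LinearEquiv.ofInjectiveOfFinrankEq f hinj (by simp)
  have he : ∀ v, e v = (v ∘ ![0, 1, 2], g.mulVec (v ∘ ![3, 4, 5])) := fun v => rfl
  have key : ∀ v, eval v (hyperPoly F₁ F₂) = 0 ↔ eval (e v).1 F₁ = eval (e v).2 F₁ := by
    intro v
    rw [hyper_eval, he, sub_eq_zero, (applyMat_iff g F₁ F₂).1 h]
  have himg : PL F₁ = (fun W => W.map e.toLinearMap) '' planesIn (hyperPoly F₁ F₂) := by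
    ext W
    constructor
    · rintro ⟨h1, h2⟩
      refine ⟨W.map e.symm.toLinearMap, ⟨?_, ?_⟩, ?_⟩
      · exact (LinearEquiv.finrank_map_eq e.symm W).trans h1
      · rintro _ ⟨w, hw, rfl⟩
        rw [key]
        simpa using h2 w hw
      · simp only [← Submodule.map_comp]; simp
    · rintro ⟨W', ⟨h1, h2⟩, rfl⟩
      refine ⟨?_, ?_⟩
      · exact (LinearEquiv.finrank_map_eq e W').trans h1
      · rintro _ ⟨w, hw, rfl⟩
        exact (key w).1 (h2 w hw)
  rw [himg, Set.ncard_image_of_injective]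
  exact Submodule.map_injective_of_injective e.injective

/-- the plane spanned by `(p,0), (0,q), (a,b)`. -/
def W3 (p q a b : Fin 3 → ℂ) : Submodule ℂ ((Fin 3 → ℂ) × (Fin 3 → ℂ)) :=
  Submodule.span ℂ {(p, 0), (0, q), (a, b)}

lemma mem_W3 {p q a b : Fin 3 → ℂ} {w} :
    w ∈ W3 p q a b ↔ ∃ s t u : ℂ, w = (s • p + u • a, t • q + u • b) := by
  rw [W3, Submodule.mem_span_triple]
  constructor
  · rintro ⟨s, t, u, rfl⟩; exact ⟨s, t, u, by simp⟩
  · rintro ⟨s, t, u, rfl⟩; exact ⟨s, t, u, by simp⟩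

lemma finrank_W3 {p q a b : Fin 3 → ℂ} (h1 : LinearIndependent ℂ ![p, a])
    (h2 : LinearIndependent ℂ ![q, b]) : Module.finrank ℂ (W3 p q a b) = 3 := by
  have hLI : LinearIndependent ℂ ![((p, 0) : (Fin 3 → ℂ) × (Fin 3 → ℂ)), (0, q), (a, b)] := by
    rw [Fintype.linearIndependent_iff]
    intro c hc
    rw [Fin.sum_univ_three] at hc
    simp only [Matrix.cons_val_zero, Matrix.cons_val_one, Matrix.cons_val, Prod.smul_mk,
      Prod.mk_add_mk, smul_zero, add_zero, zero_add, Prod.mk_eq_zero] at hc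
    have e1 := LinearIndependent.pair_iff.1 h1 _ _ hc.1
    have e2 := LinearIndependent.pair_iff.1 h2 _ _ hc.2
    intro i; fin_cases i
    · exact e1.1
    · exact e2.1
    · exact e1.2
  have hset : W3 p q a b =
      Submodule.span ℂ (Set.range ![((p, 0) : (Fin 3 → ℂ) × (Fin 3 → ℂ)), (0, q), (a, b)]) := by
    rw [W3]; congr 1
    ext w
    simp
    tauto
  rw [hset, finrank_span_eq_card hLI]
  simp

lemma W3_mem_PL {d : ℕ} {F} {p q a b : Fin 3 → ℂ} {c : ℂ} (h1 : LinearIndependent ℂ ![p, a])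
    (h2 : LinearIndependent ℂ ![q, b]) (h3 : Fl d F p a c) (h4 : Fl d F q b c) :
    W3 p q a b ∈ PL F := by
  refine ⟨finrank_W3 h1 h2, fun w hw => ?_⟩
  obtain ⟨s, t, u, rfl⟩ := mem_W3.1 hw
  rw [h3, h4]

lemma W3_fst {p q a b x : Fin 3 → ℂ} (h2 : LinearIndependent ℂ ![q, b])
    (h : (x, 0) ∈ W3 p q a b) : ∃ s : ℂ, x = s • p := by
  obtain ⟨s, t, u, h⟩ := mem_W3.1 h
  rw [Prod.mk.injEq] at h
  have := LinearIndependent.pair_iff.1 h2 _ _ h.2.symm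
  exact ⟨s, by rw [h.1, this.2]; simp⟩

lemma W3_snd {p q a b x : Fin 3 → ℂ} (h1 : LinearIndependent ℂ ![p, a])
    (h : (0, x) ∈ W3 p q a b) : ∃ s : ℂ, x = s • q := by
  obtain ⟨s, t, u, h⟩ := mem_W3.1 h
  rw [Prod.mk.injEq] at h
  have := LinearIndependent.pair_iff.1 h1 _ _ h.1.symm
  exact ⟨t, by rw [h.2, this.2]; simp⟩

lemma surj_of_inj {W : Submodule ℂ ((Fin 3 → ℂ) × (Fin 3 → ℂ))} (hW : Module.finrank ℂ W = 3)
    (f : (Fin 3 → ℂ) × (Fin 3 → ℂ) →ₗ[ℂ] (Fin 3 → ℂ)) (h : ∀ w ∈ W, f w = 0 → w = 0) :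
    ∃ e : W ≃ₗ[ℂ] (Fin 3 → ℂ), ∀ w, e w = f w := by
  have hinj : Function.Injective (f.comp W.subtype) := by
    rw [injective_iff_map_eq_zero]
    intro w hw
    exact Subtype.ext (h w w.2 hw)
  exact ⟨LinearEquiv.ofInjectiveOfFinrankEq _ hinj (by simp [hW]), fun w => rfl⟩

lemma li_of_not {p a : Fin 3 → ℂ} (hp : p ≠ 0) (h : ∀ s : ℂ, a ≠ s • p) :
    LinearIndependent ℂ ![p, a] := by
  rw [LinearIndependent.pair_iff' hp]
  intro s hs; exact h s hs.symm

lemma finrank_pair_le {V : Type*} [AddCommGroup V] [Module ℂ V] (x y : V) :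
    Module.finrank ℂ (Submodule.span ℂ {x, y}) ≤ 2 := by
  classical
  have h := finrank_span_finset_le_card (R := ℂ) ({x, y} : Finset V)
  rw [Finset.coe_insert, Finset.coe_singleton] at h
  exact h.trans Finset.card_le_two

lemma classify {d : ℕ} (hd : 3 ≤ d) {F : MvPolynomial (Fin 3) ℂ} (hF : F.IsHomogeneous d)
    (hs : Sm F) {W} (hW : W ∈ PL F) :
    (∃ g : GL (Fin 3) ℂ, applyMat g.val F = F ∧ LinearMap.graph g.val.mulVecLin = W) ∨
    ∃ p q a b : Fin 3 → ℂ, LinearIndependent ℂ ![p, a] ∧ LinearIndependent ℂ ![q, b] ∧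
      eval a F = eval b F ∧ eval a F ≠ 0 ∧ Fl d F p a (eval a F) ∧ Fl d F q b (eval a F) ∧
      (p, 0) ∈ W ∧ (0, q) ∈ W ∧ (a, b) ∈ W := by
  obtain ⟨hdim, hW⟩ := hW
  by_cases hq : ∀ y, (0, y) ∈ W → y = 0
  · left
    obtain ⟨e, he⟩ := surj_of_inj hdim (LinearMap.fst ℂ _ _) (by
      rintro ⟨x, y⟩ hw h0
      simp only [LinearMap.fst_apply] at h0
      subst h0
      rw [hq y hw]; rfl)
    let G : (Fin 3 → ℂ) →ₗ[ℂ] (Fin 3 → ℂ) :=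
      (LinearMap.snd ℂ _ _).comp (W.subtype.comp e.symm.toLinearMap)
    have hG : ∀ x, (x, G x) ∈ W := by
      intro x
      have h1 : (e.symm x : (Fin 3 → ℂ) × (Fin 3 → ℂ)).1 = x := by
        have := he (e.symm x)
        rw [e.apply_symm_apply] at this
        exact this.symm
      have h2 : (x, G x) = (e.symm x : (Fin 3 → ℂ) × (Fin 3 → ℂ)) := Prod.ext h1.symm rfl
      rw [h2]; exact (e.symm x).2
    have hGF : ∀ x, eval (G x) F = eval x F := fun x => (hW _ (hG x)).symm
    have hinj : Function.Injective G := by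
      rw [injective_iff_map_eq_zero]
      intro p hp
      by_contra hne
      exact no_cone (by omega) hF hs hne fun x => by rw [← hGF, map_add, hp, add_zero, hGF]
    have hunit : IsUnit (LinearMap.toMatrix' G) := by
      rw [← Matrix.mulVec_injective_iff_isUnit]
      intro x y hxy
      apply hinj
      simpa [LinearMap.toMatrix'_mulVec] using hxy
    have hGm : (LinearMap.toMatrix' G).mulVecLin = G := by
      rw [← Matrix.toLin'_apply', Matrix.toLin'_toMatrix']
    refine ⟨hunit.unit, ?_, ?_⟩
    · rw [applyMat_iff]
      intro x
      rw [← hGF x]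
      simp [LinearMap.toMatrix'_mulVec]
    · change LinearMap.graph (LinearMap.toMatrix' G).mulVecLin = W
      rw [hGm]
      ext ⟨x, y⟩
      rw [LinearMap.mem_graph_iff]
      constructor
      · intro h; simp only at h; rw [h]; exact hG x
      · intro h
        have := W.sub_mem h (hG x)
        rw [Prod.mk_sub_mk, sub_self] at this
        exact sub_eq_zero.1 (hq _ this)
  · right
    push Not at hq
    obtain ⟨q, hq, hq0⟩ := hq
    obtain ⟨p, hp, hp0⟩ : ∃ p, (p, 0) ∈ W ∧ p ≠ 0 := by
      by_contra! hall
      obtain ⟨e, he⟩ := surj_of_inj hdim (LinearMap.snd ℂ _ _) (by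
        rintro ⟨x, y⟩ hw h0
        simp only [LinearMap.snd_apply] at h0
        subst h0
        rw [hall x hw]; rfl)
      refine no_cone (by omega) hF hs hq0 fun z => ?_
      have h1 : (e.symm z : (Fin 3 → ℂ) × (Fin 3 → ℂ)).2 = z := by
        have := he (e.symm z)
        rw [e.apply_symm_apply] at this
        exact this.symm
      have h2 := hW _ (e.symm z).2
      have h3 := hW _ (W.add_mem (e.symm z).2 hq)
      simp only [Prod.fst_add, Prod.snd_add, add_zero, h1] at h2 h3
      rw [← h2, ← h3]
    obtain ⟨⟨a, b⟩, hab, hn⟩ : ∃ w ∈ W, w ∉ Submodule.span ℂ {((p, 0) : (Fin 3 → ℂ) × (Fin 3 → ℂ)), (0, q)} := by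
      by_contra! hle
      have h2 := (Submodule.finrank_mono (show W ≤ _ from hle)).trans
        (finrank_pair_le ((p, 0) : (Fin 3 → ℂ) × (Fin 3 → ℂ)) (0, q))
      rw [hdim] at h2
      omega
    have hn' : ∀ s t : ℂ, (a, b) ≠ (s • p, t • q) := by
      intro s t h
      apply hn
      rw [Submodule.mem_span_pair]
      exact ⟨s, t, by rw [h]; simp⟩
    have hz := eval_zero_hom (F := F) (by omega) hF
    have hmem : ∀ s t u : ℂ, (s • p + u • a, t • q + u • b) ∈ W := by
      intro s t u
      have := W.add_mem (W.add_mem (W.smul_mem s hp) (W.smul_mem t hq)) (W.smul_mem u hab)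
      simpa using this
    have hLp : LinearIndependent ℂ ![p, a] := by
      refine li_of_not hp0 fun s hsa => ?_
      have hLI : LinearIndependent ℂ ![q, b] := by
        refine li_of_not hq0 fun t htb => hn' s t (by rw [hsa, htb])
      refine no_line (by omega) hF hs hLI fun t u => ?_
      have := hW (_, _) (hmem (-(u * s)) t u)
      simp only at this
      rw [← this, hsa, smul_smul, ← add_smul, neg_add_cancel, zero_smul, hz]
    have hLq : LinearIndependent ℂ ![q, b] := by
      refine li_of_not hq0 fun s hsa => ?_
      refine no_line (by omega) hF hs hLp fun t u => ?_
      have := hW (_, _) (hmem t (-(u * s)) u)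
      simp only at this
      rw [this, hsa, smul_smul, ← add_smul, neg_add_cancel, zero_smul, hz]
    have hFab : eval a F = eval b F := hW (a, b) hab
    have hFp : Fl d F p a (eval a F) := by
      intro s t
      have := hW _ (hmem s 0 t)
      simp only [zero_smul, zero_add] at this
      rw [this, eval_smul_hom hF, hFab, mul_comm]
    have hFq : Fl d F q b (eval a F) := by
      intro s t
      have := hW _ (hmem 0 s t)
      simp only [zero_smul, zero_add] at this
      rw [← this, eval_smul_hom hF, mul_comm]
    refine ⟨p, q, a, b, hLp, hLq, hFab, ?_, hFp, hFq, hp, hq, hab⟩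
    intro h0
    rw [h0] at hFp
    exact no_line (by omega) hF hs hLp fun s t => by rw [hFp, zero_mul]

lemma li_smul {p a : Fin 3 → ℂ} (h : LinearIndependent ℂ ![p, a]) {u z : ℂ} (hu : u ≠ 0)
    (hz : z ≠ 0) : LinearIndependent ℂ ![u • p, z • a] := by
  rw [LinearIndependent.pair_iff] at h ⊢
  intro s t hst
  rw [smul_smul, smul_smul] at hst
  have := h _ _ hst
  exact ⟨(mul_eq_zero.1 this.1).resolve_right hu, (mul_eq_zero.1 this.2).resolve_right hz⟩

lemma Fl.scale {d : ℕ} {F : MvPolynomial (Fin 3) ℂ} {p a : Fin 3 → ℂ} {c : ℂ} (h : Fl d F p a c)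
    (u z : ℂ) : Fl d F (u • p) (z • a) (c * z ^ d) := by
  intro s t
  rw [smul_smul, smul_smul, h, mul_pow]; ring

lemma proj_eq {x y : Projectivization ℂ (Fin 3 → ℂ)} {s : ℂ} (h : x.rep = s • y.rep) : x = y := by
  have hs : s • y.rep = x.rep := h.symm
  rw [← x.mk_rep, ← y.mk_rep, Projectivization.mk_eq_mk_iff']
  exact ⟨s, hs⟩

/-- Chosen generator at a flex: a flex point with `p, b` and its normalised `a`. -/
lemma flex_param {d : ℕ} (hd : 3 ≤ d) {F : MvPolynomial (Fin 3) ℂ} (hs : Sm F)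
    {p b : Fin 3 → ℂ} {c : ℂ} (hc : c ≠ 0) (hli : LinearIndependent ℂ ![p, b])
    (h : Fl d F p b c) (A : Projectivization ℂ (Fin 3 → ℂ) → (Fin 3 → ℂ))
    (hA : ∀ x : Projectivization ℂ (Fin 3 → ℂ), IsDFlexRep d F x.rep →
      LinearIndependent ℂ ![x.rep, A x] ∧ Fl d F x.rep (A x) 1) :
    ∃ x : Projectivization ℂ (Fin 3 → ℂ), IsDFlexRep d F x.rep ∧
      ∃ u m l : ℂ, x.rep = u • p ∧ A x = m • p + l • b ∧ c * l ^ d = 1 := by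
  have hp0 : p ≠ 0 := hli.ne_zero 0
  obtain ⟨u, hu⟩ := Projectivization.exists_smul_eq_mk_rep ℂ p hp0
  set x := Projectivization.mk ℂ p hp0 with hx
  have hu' : x.rep = (u : ℂ) • p := hu.symm
  obtain ⟨z, hz⟩ := IsAlgClosed.exists_pow_nat_eq c⁻¹ (show 0 < d by omega)
  have hz0 : z ≠ 0 := by
    rintro rfl
    rw [zero_pow (by omega)] at hz
    exact inv_ne_zero hc hz.symm
  have hfl : IsDFlexRep d F x.rep := by
    rw [isDFlex_iff (by omega)]
    refine ⟨z • b, ?_, ?_⟩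
    · rw [hu']; exact li_smul hli u.ne_zero hz0
    · rw [hu']
      have := h.scale u z
      rwa [hz, mul_inv_cancel₀ hc] at this
  refine ⟨x, hfl, u, ?_⟩
  have h2 := (hA x hfl).2
  have h1 : Fl d F x.rep b c := by
    have := h.scale u 1
    rwa [one_smul, one_pow, mul_one, ← hu'] at this
  have hli1 : LinearIndependent ℂ ![x.rep, b] := by
    have := li_smul hli u.ne_zero one_ne_zero
    rwa [one_smul, ← hu'] at this
  obtain ⟨m, l, hml⟩ := Fl.unique (by omega) hs h1 hli1 h2
  refine ⟨m * u, l, hu', by rw [hml, hu', smul_smul], ?_⟩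
  have e1 := h2 0 1
  rw [zero_smul, zero_add, one_smul, one_pow, mul_one, hml, h1] at e1
  exact e1

theorem PL_count {d : ℕ} (hd : 3 ≤ d) {F : MvPolynomial (Fin 3) ℂ} (hF : F.IsHomogeneous d)
    (hs : Sm F) : (PL F).ncard
      = d * (flexCount d F) ^ 2 + Nat.card {g : GL (Fin 3) ℂ // applyMat g.val F = F} := by
  classical
  have hex : ∀ x : Projectivization ℂ (Fin 3 → ℂ), ∃ a, IsDFlexRep d F x.rep →
      LinearIndependent ℂ ![x.rep, a] ∧ Fl d F x.rep a 1 := by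
    intro x
    by_cases h : IsDFlexRep d F x.rep
    · obtain ⟨a, h1, h2⟩ := (isDFlex_iff (by omega) F _).1 h
      exact ⟨a, fun _ => ⟨h1, h2⟩⟩
    · exact ⟨0, fun h' => absurd h' h⟩
  choose A hA using hex
  have : NeZero d := ⟨by omega⟩
  let S : Set (Projectivization ℂ (Fin 3 → ℂ)) := {x | IsDFlexRep d F x.rep}
  have hroot : ∀ ζ : rootsOfUnity d ℂ, ((ζ : ℂˣ) : ℂ) ^ d = 1 := by
    intro ζ
    have := (mem_rootsOfUnity d _).1 ζ.2
    rw [← Units.val_pow_eq_pow_val, this, Units.val_one]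
  have hLI' : ∀ y ∈ S, ∀ ζ : rootsOfUnity d ℂ,
      LinearIndependent ℂ ![y.rep, ((ζ : ℂˣ) : ℂ) • A y] := by
    intro y hy ζ
    have := li_smul (hA y hy).1 one_ne_zero (ζ : ℂˣ).ne_zero
    rwa [one_smul] at this
  have hFl' : ∀ y ∈ S, ∀ ζ : rootsOfUnity d ℂ, Fl d F y.rep (((ζ : ℂˣ) : ℂ) • A y) 1 := by
    intro y hy ζ
    have := (hA y hy).2.scale 1 ((ζ : ℂˣ) : ℂ)
    rwa [one_smul, hroot, mul_one] at this
  let Ψ : (S × S × rootsOfUnity d ℂ) ⊕ {g : GL (Fin 3) ℂ // applyMat g.val F = F} →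
      Submodule ℂ ((Fin 3 → ℂ) × (Fin 3 → ℂ)) :=
    Sum.elim (fun t => W3 t.1.1.rep t.2.1.1.rep (A t.1.1) (((t.2.2 : ℂˣ) : ℂ) • A t.2.1.1))
      (fun g => LinearMap.graph g.1.val.mulVecLin)
  have hinl : ∀ t, Ψ (Sum.inl t) =
      W3 t.1.1.rep t.2.1.1.rep (A t.1.1) (((t.2.2 : ℂˣ) : ℂ) • A t.2.1.1) := fun t => rfl
  have hinr : ∀ g, Ψ (Sum.inr g) = LinearMap.graph g.1.val.mulVecLin := fun t => rfl
  have hne : ∀ t g, Ψ (Sum.inl t) ≠ Ψ (Sum.inr g) := by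
    rintro ⟨⟨x, hx⟩, ⟨y, hy⟩, ζ⟩ g h
    have h1 : ((0, y.rep) : (Fin 3 → ℂ) × (Fin 3 → ℂ)) ∈ Ψ (Sum.inl (⟨x, hx⟩, ⟨y, hy⟩, ζ)) := by
      rw [hinl, mem_W3]; exact ⟨0, 1, 0, by simp⟩
    rw [h, hinr, LinearMap.mem_graph_iff] at h1
    simp only [map_zero] at h1
    exact y.rep_nonzero h1
  have hΨinj : Function.Injective Ψ := by
    rintro (⟨⟨x, hx⟩, ⟨y, hy⟩, ζ⟩ | g) (⟨⟨x', hx'⟩, ⟨y', hy'⟩, ζ'⟩ | g') h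
    · rw [hinl, hinl] at h
      simp only at h
      have h1 : ((x.rep, 0) : (Fin 3 → ℂ) × (Fin 3 → ℂ)) ∈ W3 x'.rep y'.rep (A x') (((ζ' : ℂˣ) : ℂ) • A y') := by
        rw [← h, mem_W3]; exact ⟨1, 0, 0, by simp⟩
      obtain ⟨s, hs1⟩ := W3_fst (hLI' y' hy' ζ') h1
      obtain rfl := proj_eq hs1
      have h2 : ((0, y.rep) : (Fin 3 → ℂ) × (Fin 3 → ℂ)) ∈ W3 x.rep y'.rep (A x) (((ζ' : ℂˣ) : ℂ) • A y') := by
        rw [← h, mem_W3]; exact ⟨0, 1, 0, by simp⟩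
      obtain ⟨s, hs2⟩ := W3_snd (hA x hx).1 h2
      obtain rfl := proj_eq hs2
      have h3 : ((A x, ((ζ : ℂˣ) : ℂ) • A y) : (Fin 3 → ℂ) × (Fin 3 → ℂ)) ∈ W3 x.rep y.rep (A x) (((ζ' : ℂˣ) : ℂ) • A y) := by
        rw [← h, mem_W3]; exact ⟨0, 0, 1, by simp⟩
      have h4 : ((A x, ((ζ' : ℂˣ) : ℂ) • A y) : (Fin 3 → ℂ) × (Fin 3 → ℂ)) ∈ W3 x.rep y.rep (A x) (((ζ' : ℂˣ) : ℂ) • A y) := by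
        rw [mem_W3]; exact ⟨0, 0, 1, by simp⟩
      have h5 := Submodule.sub_mem _ h3 h4
      rw [Prod.mk_sub_mk, sub_self, ← sub_smul] at h5
      obtain ⟨s, hs3⟩ := W3_snd (hA x hx).1 h5
      have h6 := LinearIndependent.pair_iff.1 (hA y hy).1 (-s) (((ζ : ℂˣ) : ℂ) - ((ζ' : ℂˣ) : ℂ))
        (by rw [hs3, neg_smul, neg_add_cancel])
      have h7 : ζ = ζ' := Subtype.ext (Units.ext (sub_eq_zero.1 h6.2))
      rw [h7]
    · exact absurd h (hne _ _)
    · exact absurd h.symm (hne _ _)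
    · rw [hinr, hinr] at h
      congr 1
      apply Subtype.ext
      apply Units.ext
      apply Matrix.mulVec_injective
      funext v
      have h1 : ((v, g.1.val.mulVec v) : (Fin 3 → ℂ) × (Fin 3 → ℂ)) ∈ LinearMap.graph g.1.val.mulVecLin := by
        rw [LinearMap.mem_graph_iff]; rfl
      rw [h, LinearMap.mem_graph_iff] at h1
      exact h1
  have hrange : Set.range Ψ = PL F := by
    ext W
    constructor
    · rintro ⟨(⟨⟨x, hx⟩, ⟨y, hy⟩, ζ⟩ | g), rfl⟩
      · rw [hinl]
        exact W3_mem_PL (hA x hx).1 (hLI' y hy ζ) (hA x hx).2 (hFl' y hy ζ)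
      · rw [hinr]
        refine ⟨?_, ?_⟩
        · have : LinearMap.graph g.1.val.mulVecLin =
              LinearMap.range (LinearMap.id.prod g.1.val.mulVecLin) := LinearMap.graph_eq_range_prod _
          rw [this, LinearMap.finrank_range_of_inj]
          · simp
          · intro a b hab
            exact congrArg Prod.fst hab
        · rintro ⟨a, b⟩ hab
          rw [LinearMap.mem_graph_iff] at hab
          have := (applyMat_iff g.1.val F F).1 g.2 a
          simp only [Matrix.mulVecLin_apply] at hab
          rw [hab, this]
    · intro hW
      rcases classify hd hF hs hW with ⟨g, hg, rfl⟩ | ⟨p, q, a, b, h1, h2, h3, h4, h5, h6, h7, h8, h9⟩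
      · exact ⟨Sum.inr ⟨g, hg⟩, rfl⟩
      · obtain ⟨x, hx, u, m, l, e1, e2, e3⟩ := flex_param hd hs h4 h1 h5 A hA
        obtain ⟨y, hy, u', m', l', e1', e2', e3'⟩ := flex_param hd hs h4 h2 h6 A hA
        have hl' : l' ≠ 0 := by
          rintro rfl
          rw [zero_pow (by omega), mul_zero] at e3'
          exact zero_ne_one e3'
        have hζ : (l / l') ^ d = 1 := by
          rw [div_pow, div_eq_one_iff_eq (pow_ne_zero _ hl')]
          exact mul_left_cancel₀ h4 (e3.trans e3'.symm)
        have hζ0 : l / l' ≠ 0 := by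
          intro h0
          rw [h0, zero_pow (by omega)] at hζ
          exact zero_ne_one hζ
        let ζ : rootsOfUnity d ℂ := ⟨Units.mk0 _ hζ0, by
          rw [mem_rootsOfUnity]; ext; simpa using hζ⟩
        refine ⟨Sum.inl (⟨x, hx⟩, ⟨y, hy⟩, ζ), ?_⟩
        rw [hinl]
        have hPL := W3_mem_PL (hA x hx).1 (hLI' y hy ζ) (hA x hx).2 (hFl' y hy ζ)
        have : FiniteDimensional ℂ W := inferInstance
        refine Submodule.eq_of_le_of_finrank_eq ?_ (hPL.1.trans hW.1.symm)
        intro w hw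
        obtain ⟨s, t, v, rfl⟩ := mem_W3.1 hw
        have hζv : ((ζ : ℂˣ) : ℂ) = l / l' := rfl
        have key : ((s • x.rep + v • A x, t • y.rep + v • ((ζ : ℂˣ) : ℂ) • A y) :
            (Fin 3 → ℂ) × (Fin 3 → ℂ)) = (s * u + v * m) • (p, 0)
              + (t * u' + v * (l / l') * m') • (0, q) + (v * l) • (a, b) := by
          rw [e1, e2, e1', e2', hζv]
          have : l = l / l' * l' := by field_simp
          ext i
          · simp; ring
          · simp; field_simp; ring
        simp only at key ⊢
        rw [key]
        exact W.add_mem (W.add_mem (W.smul_mem _ h7) (W.smul_mem _ h8)) (W.smul_mem _ h9)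
  have : Finite S := (flex_finite hd hs).to_subtype
  have : Finite {g : GL (Fin 3) ℂ // applyMat g.val F = F} := by
    have := (autMat_finite hd hF hs).to_subtype
    refine Finite.of_injective (β := {g : Matrix (Fin 3) (Fin 3) ℂ | applyMat g F = F})
      (fun g => ⟨g.1.val, g.2⟩) ?_
    intro g g' h
    exact Subtype.ext (Units.ext (congrArg Subtype.val h))
  rw [← hrange, ← Nat.card_coe_set_eq, Nat.card_range_of_injective hΨinj, Nat.card_sum,
    Nat.card_prod, Nat.card_prod]
  have hr : Nat.card (rootsOfUnity d ℂ) = d := Complex.card_rootsOfUnity d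
  have hS : Nat.card S = flexCount d F := Nat.card_coe_set_eq S
  rw [hr, hS]
  ring

/-- Let `X ⊂ ℙ⁵` be a smooth hypersurface of degree `d ≥ 3` defined by
`F₁(x₀,x₁,x₂) = F₂(y₀,y₁,y₂)` with `F₁ ∼ F₂`, and let `ν` be the number of `d`-flex points
of the curve `F₁ = 0`. Then `X` contains exactly `d·ν² + |Aut(F₁)|` planes. -/
theorem stmt_11 (d : ℕ) (hd : 3 ≤ d) (F₁ F₂ : MvPolynomial (Fin 3) ℂ)
    (hF₁ : F₁.IsHomogeneous d) (hF₂ : F₂.IsHomogeneous d)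
    (hsmooth : ∀ v : Fin 6 → ℂ, v ≠ 0 →
      ¬ (eval v (hyperPoly F₁ F₂) = 0 ∧ ∀ i, eval v (pderiv i (hyperPoly F₁ F₂)) = 0))
    (hequiv : ∃ g : Matrix (Fin 3) (Fin 3) ℂ, IsUnit g.det ∧ applyMat g F₁ = F₂) :
    (planesIn (hyperPoly F₁ F₂)).ncard
      = d * (flexCount d F₁) ^ 2
        + Nat.card {g : GL (Fin 3) ℂ // applyMat g.val F₁ = F₁} := by
  obtain ⟨g, hg, h⟩ := hequiv
  have hs := sm_of_hyper hd hF₁ hF₂ hsmooth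
  rw [planes_ncard g hg h]
  exact PL_count hd hF₁ hs

end
end

section
/- Let F be a ternary cubic form over ℂ defining a smooth cubic curve, and let X ⊂ ℙ⁵ be the smooth cubic fourfold F(x₀,x₁,x₂) = F(y₀,y₁,y₂). Then the number of planes in X equals 243 + |Aut(F)|, which is 405 if the elliptic curve F = 0 has j-invariant 0, 351 if j = 1728, and 297 otherwise. -/
open MvPolynomial

noncomputable section

/-- The homogeneous Weierstrass cubic
`Y²Z + a₁XYZ + a₃YZ² - X³ - a₂X²Z - a₄XZ² - a₆Z³` (with `X,Y,Z` indexed by `0,1,2`). -/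
def wPoly (E : WeierstrassCurve ℂ) : MvPolynomial (Fin 3) ℂ :=
  X 1 ^ 2 * X 2 + C E.a₁ * (X 0 * X 1 * X 2) + C E.a₃ * (X 1 * X 2 ^ 2)
    - (X 0 ^ 3 + C E.a₂ * (X 0 ^ 2 * X 2) + C E.a₄ * (X 0 * X 2 ^ 2) + C E.a₆ * X 2 ^ 3)

/-- The smooth plane cubic `F = 0` has j-invariant `j₀`: `F` is linearly equivalent to the
homogeneous Weierstrass cubic of an elliptic curve with j-invariant `j₀`. -/
def HasJInvariant (F : MvPolynomial (Fin 3) ℂ) (j₀ : ℂ) : Prop :=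
  ∃ (E : WeierstrassCurve ℂ) (hE : E.IsElliptic),
    @WeierstrassCurve.j ℂ _ E hE = j₀ ∧
      ∃ g : Matrix (Fin 3) (Fin 3) ℂ, IsUnit g.det ∧ applyMat g F = wPoly E

set_option linter.unusedSimpArgs false

/-- The space `ℂ³`. -/
abbrev V3 : Type := Fin 3 → ℂ

/-- Trilinear forms on `ℂ³`. -/
abbrev Tri : Type := V3 →ₗ[ℂ] V3 →ₗ[ℂ] V3 →ₗ[ℂ] ℂ

/-- Symmetric trilinear forms whose associated cubic is smooth. -/
structure Cub (T : Tri) : Prop where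
  s12 : ∀ u v w, T u v w = T v u w
  s23 : ∀ u v w, T u v w = T u w v
  smooth : ∀ v, v ≠ 0 → ∃ w, T v v w ≠ 0

/-- Flex points, in terms of the polarization. -/
def Flex (T : Tri) (p : V3) : Prop :=
  p ≠ 0 ∧ T p p p = 0 ∧ ∃ q, (∀ c : ℂ, q ≠ c • p) ∧ T p p q = 0 ∧ T p q q = 0

lemma pderiv_comm' (F : MvPolynomial (Fin 3) ℂ) (i j : Fin 3) :
    pderiv i (pderiv j F) = pderiv j (pderiv i F) := by
  have h : ⁅(pderiv i : Derivation ℂ (MvPolynomial (Fin 3) ℂ) (MvPolynomial (Fin 3) ℂ)),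
      (pderiv j : Derivation ℂ (MvPolynomial (Fin 3) ℂ) (MvPolynomial (Fin 3) ℂ))⁆ = 0 := by
    apply MvPolynomial.derivation_ext
    intro k
    rw [Derivation.commutator_apply]
    simp [pderiv_X, Pi.single_apply]
    split_ifs <;> simp
  have := congrArg (fun D => D F) h
  simp only [Derivation.commutator_apply] at this
  exact sub_eq_zero.mp this

lemma euler_eval {n : ℕ} {G : MvPolynomial (Fin 3) ℂ} (h : G.IsHomogeneous n) (v : V3) :
    ∑ i, v i * eval v (pderiv i G) = n * eval v G := by
  have := congrArg (eval v) h.sum_X_mul_pderiv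
  simpa using this

lemma eval_hom0 {G : MvPolynomial (Fin 3) ℂ} (h : G.IsHomogeneous 0) (v : V3) :
    eval v G = eval 0 G := by
  obtain ⟨c, rfl⟩ : ∃ c, G = C c := ⟨_, (totalDegree_eq_zero_iff_eq_C.mp
    (Nat.le_zero.mp (h.totalDegree_le)))⟩
  simp

/-- Coefficients of the polarization. -/
def coefT (F : MvPolynomial (Fin 3) ℂ) (i j k : Fin 3) : ℂ :=
  eval 0 (pderiv k (pderiv j (pderiv i F))) / 6

/-- The polarization. -/
def polT (F : MvPolynomial (Fin 3) ℂ) : Tri :=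
  ∑ i, ∑ j, ∑ k, (LinearMap.proj i).smulRight ((LinearMap.proj j).smulRight
    (coefT F i j k • (LinearMap.proj k : V3 →ₗ[ℂ] ℂ)))

lemma polT_apply (F : MvPolynomial (Fin 3) ℂ) (u v w : V3) :
    polT F u v w = ∑ i, ∑ j, ∑ k, u i * (v j * (coefT F i j k * w k)) := by
  simp [polT, LinearMap.sum_apply]

lemma coefT_s12 (F : MvPolynomial (Fin 3) ℂ) (i j k) : coefT F i j k = coefT F j i k := by
  rw [coefT, pderiv_comm' F j i, coefT]

lemma coefT_s23 (F : MvPolynomial (Fin 3) ℂ) (i j k) : coefT F i j k = coefT F i k j := by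
  rw [coefT, pderiv_comm' _ k j, coefT]

lemma polT_s12 (F : MvPolynomial (Fin 3) ℂ) (u v w : V3) : polT F u v w = polT F v u w := by
  rw [polT_apply, polT_apply, Finset.sum_comm]
  refine Finset.sum_congr rfl fun i _ => Finset.sum_congr rfl fun j _ =>
    Finset.sum_congr rfl fun k _ => ?_
  rw [coefT_s12]; ring

lemma polT_s23 (F : MvPolynomial (Fin 3) ℂ) (u v w : V3) : polT F u v w = polT F u w v := by
  rw [polT_apply, polT_apply]
  refine Finset.sum_congr rfl fun i _ => ?_
  rw [Finset.sum_comm]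
  refine Finset.sum_congr rfl fun j _ =>
    Finset.sum_congr rfl fun k _ => ?_
  rw [coefT_s23]; ring

lemma polT_grad (F : MvPolynomial (Fin 3) ℂ) (hF : F.IsHomogeneous 3) (v : V3) (i : Fin 3) :
    eval v (pderiv i F) = 3 * ∑ j, ∑ k, v j * (coefT F i j k * v k) := by
  have h2 : (pderiv i F).IsHomogeneous 2 := hF.pderiv
  have e2 := euler_eval h2 v
  have e1 : ∀ j, ∑ k, v k * eval 0 (pderiv k (pderiv j (pderiv i F))) =
      eval v (pderiv j (pderiv i F)) := by
    intro j
    have h1 : (pderiv j (pderiv i F)).IsHomogeneous 1 := h2.pderiv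
    have := euler_eval h1 v
    rw [Nat.cast_one, one_mul] at this
    rw [← this]
    refine Finset.sum_congr rfl fun k _ => ?_
    have h0 : (pderiv k (pderiv j (pderiv i F))).IsHomogeneous 0 := h1.pderiv
    rw [eval_hom0 h0 v]
  simp only [← e1] at e2
  simp only [coefT]
  simp only [Fin.sum_univ_three] at e2 ⊢
  push_cast at e2
  linear_combination (-1/2) * e2

lemma polT_eval (F : MvPolynomial (Fin 3) ℂ) (hF : F.IsHomogeneous 3) (v : V3) :
    eval v F = polT F v v v := by
  have e := euler_eval hF v
  simp only [polT_grad F hF] at e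
  rw [polT_apply]
  simp only [Fin.sum_univ_three] at e ⊢
  push_cast at e
  linear_combination (-1/3) * e

lemma polT_cub (F : MvPolynomial (Fin 3) ℂ) (hF : F.IsHomogeneous 3)
    (hsmooth : ∀ v : Fin 3 → ℂ, v ≠ 0 →
      ¬ (eval v F = 0 ∧ ∀ i, eval v (pderiv i F) = 0)) : Cub (polT F) := by
  refine ⟨polT_s12 F, polT_s23 F, fun v hv => ?_⟩
  by_contra! hcon
  refine hsmooth v hv ⟨by rw [polT_eval F hF, hcon], fun i => ?_⟩
  have := hcon (Pi.single i 1)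
  rw [polT_s23, polT_s12, polT_apply] at this
  rw [polT_grad F hF]
  simp only [Pi.single_apply, ite_mul, one_mul, zero_mul] at this
  rw [Finset.sum_eq_single i (by intro b _ hb; simp [hb]) (by simp)] at this
  simp only [if_true] at this
  rw [this, mul_zero]

/-! ### Two ternary forms have a common zero -/

lemma height_origin : (3 : ℕ∞) ≤
    (RingHom.ker (aeval (fun _ => 0 : Fin 3 → ℂ) :
      MvPolynomial (Fin 3) ℂ →ₐ[ℂ] ℂ).toRingHom).height := by
  set P3 := RingHom.ker (aeval (fun _ => 0 : Fin 3 → ℂ) :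
      MvPolynomial (Fin 3) ℂ →ₐ[ℂ] ℂ).toRingHom with h3
  set P2 := RingHom.ker (aeval ![0, 0, X 2] :
      MvPolynomial (Fin 3) ℂ →ₐ[ℂ] MvPolynomial (Fin 3) ℂ).toRingHom with h2
  set P1 := RingHom.ker (aeval ![0, X 1, X 2] :
      MvPolynomial (Fin 3) ℂ →ₐ[ℂ] MvPolynomial (Fin 3) ℂ).toRingHom with h1
  have i3 : P3.IsPrime := RingHom.ker_isPrime _
  have i2 : P2.IsPrime := RingHom.ker_isPrime _
  have i1 : P1.IsPrime := RingHom.ker_isPrime _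
  have l23 : P2 < P3 := by
    refine lt_of_le_of_ne (fun x hx => ?_) fun h => ?_
    · have : aeval ![0, 0, X 2] x = (0 : MvPolynomial (Fin 3) ℂ) := hx
      change aeval _ x = 0
      have h := congrArg (aeval (fun _ => 0 : Fin 3 → ℂ)) this
      rw [map_zero, ← AlgHom.comp_apply, comp_aeval] at h
      have e : (fun _ => 0 : Fin 3 → ℂ) = fun i => aeval (fun _ => 0 : Fin 3 → ℂ)
          ((![0, 0, X 2] : Fin 3 → MvPolynomial (Fin 3) ℂ) i) := by
        funext i; fin_cases i <;> simp
      rw [← e] at h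
      exact h
    · have : (X 2 : MvPolynomial (Fin 3) ℂ) ∈ P3 := by
        change aeval _ (X 2) = 0; simp
      rw [← h] at this
      have : aeval ![0, 0, X 2] (X 2) = (0 : MvPolynomial (Fin 3) ℂ) := this
      simp at this
  have l12 : P1 < P2 := by
    refine lt_of_le_of_ne (fun x hx => ?_) fun h => ?_
    · have : aeval ![0, X 1, X 2] x = (0 : MvPolynomial (Fin 3) ℂ) := hx
      change aeval _ x = 0
      have h := congrArg (aeval (![0, 0, X 2] : Fin 3 → MvPolynomial (Fin 3) ℂ)) this
      rw [map_zero, ← AlgHom.comp_apply, comp_aeval] at h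
      have e : (![0, 0, X 2] : Fin 3 → MvPolynomial (Fin 3) ℂ) = fun i =>
          aeval (![0, 0, X 2] : Fin 3 → MvPolynomial (Fin 3) ℂ)
          ((![0, X 1, X 2] : Fin 3 → MvPolynomial (Fin 3) ℂ) i) := by
        funext i; fin_cases i <;> simp
      rw [← e] at h
      exact h
    · have : (X 1 : MvPolynomial (Fin 3) ℂ) ∈ P2 := by
        change aeval _ (X 1) = 0; simp
      rw [← h] at this
      have : aeval ![0, X 1, X 2] (X 1) = (0 : MvPolynomial (Fin 3) ℂ) := this
      simp at this
  have l01 : (⊥ : Ideal (MvPolynomial (Fin 3) ℂ)) < P1 := by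
    refine lt_of_le_of_ne bot_le fun h => ?_
    have : (X 0 : MvPolynomial (Fin 3) ℂ) ∈ P1 := by
      change aeval _ (X 0) = 0; simp
    rw [← h] at this
    simp at this
  have g1 := Ideal.height_add_one_le_of_lt_of_isPrime l01
  have g2 := Ideal.height_add_one_le_of_lt_of_isPrime l12
  have g3 := Ideal.height_add_one_le_of_lt_of_isPrime l23
  calc (3 : ℕ∞) = 0 + 1 + 1 + 1 := by norm_num
    _ ≤ (⊥ : Ideal (MvPolynomial (Fin 3) ℂ)).height + 1 + 1 + 1 := by gcongr; simp
    _ ≤ P1.height + 1 + 1 := by gcongr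
    _ ≤ P2.height + 1 := by gcongr
    _ ≤ P3.height := g3

lemma exists_common_zero (F G : MvPolynomial (Fin 3) ℂ) (hF : eval 0 F = 0) (hG : eval 0 G = 0) :
    ∃ v : V3, v ≠ 0 ∧ eval v F = 0 ∧ eval v G = 0 := by
  by_contra! hcon
  set I : Ideal (MvPolynomial (Fin 3) ℂ) := Ideal.span {F, G}
  set P3 := RingHom.ker (aeval (fun _ => 0 : Fin 3 → ℂ) :
      MvPolynomial (Fin 3) ℂ →ₐ[ℂ] ℂ).toRingHom with h3
  have i3 : P3.IsPrime := RingHom.ker_isPrime _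
  have hz : zeroLocus ℂ I = {0} := by
    ext v
    rw [zeroLocus_span]
    simp only [Set.mem_ofPred_eq, Set.mem_singleton_iff, Set.mem_insert_iff, forall_eq_or_imp,
      forall_eq]
    constructor
    · rintro ⟨h1, h2⟩
      by_contra hv
      exact hcon v hv h1 h2
    · rintro rfl
      exact ⟨hF, hG⟩
  have hr : I.radical = P3 := by
    rw [← vanishingIdeal_zeroLocus_eq_radical (K := ℂ), hz]
    ext p
    rw [mem_vanishingIdeal_singleton_iff]
    rfl
  have hm : P3 ∈ I.minimalPrimes := by
    rw [← Ideal.radical_minimalPrimes, hr, Ideal.minimalPrimes_eq_subsingleton_self]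
    rfl
  have := Ideal.height_le_card_of_mem_minimalPrimes_span (Set.toFinite _) hm
  have h4 := height_origin.trans this
  have h5 : ({F, G} : Set (MvPolynomial (Fin 3) ℂ)).ncard ≤ 2 := by
    simpa using Set.ncard_insert_le F {G}
  have : 3 ≤ ({F, G} : Set (MvPolynomial (Fin 3) ℂ)).ncard := by exact_mod_cast h4
  omega

lemma exists_equiv_of_li (u0 u1 u2 : V3) (h : LinearIndependent ℂ ![u0, u1, u2]) :
    ∃ e : V3 ≃ₗ[ℂ] V3, ∀ v, e v = v 0 • u0 + v 1 • u1 + v 2 • u2 := by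
  let b := basisOfLinearIndependentOfCardEqFinrank h (by simp)
  refine ⟨b.equivFun.symm, fun v => ?_⟩
  rw [Module.Basis.equivFun_symm_apply, Fin.sum_univ_three]
  simp [b]

lemma li3 (u0 u1 u2 : V3)
    (h : ∀ a b c : ℂ, a • u0 + b • u1 + c • u2 = 0 → a = 0 ∧ b = 0 ∧ c = 0) :
    LinearIndependent ℂ ![u0, u1, u2] := by
  rw [Fintype.linearIndependent_iff]
  intro g hg
  rw [Fin.sum_univ_three] at hg
  obtain ⟨h0, h1, h2⟩ := h _ _ _ hg
  intro i
  fin_cases i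
  · exact h0
  · exact h1
  · exact h2

lemma pair_indep {p q : V3} (hp : p ≠ 0) (hq : ∀ c : ℂ, q ≠ c • p) {a b : ℂ}
    (h : a • p + b • q = 0) : a = 0 ∧ b = 0 := by
  have hb : b = 0 := by
    by_contra hb
    apply hq (-(b⁻¹ * a))
    have := congrArg (fun x => b⁻¹ • x) h
    simp only [smul_add, smul_smul, inv_mul_cancel₀ hb, one_smul, smul_zero] at this
    rw [neg_smul]
    exact eq_neg_of_add_eq_zero_right this
  subst hb
  simp [hp] at h
  exact ⟨h, rfl⟩

lemma exists_quad_root (A B C : ℂ) : ∃ s t : ℂ, (s ≠ 0 ∨ t ≠ 0) ∧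
    A * s ^ 2 + B * s * t + C * t ^ 2 = 0 := by
  by_cases hA : A = 0
  · exact ⟨1, 0, Or.inl one_ne_zero, by simp [hA]⟩
  · obtain ⟨d, hd⟩ := IsAlgClosed.exists_pow_nat_eq (B ^ 2 - 4 * A * C) (n := 2) (by norm_num)
    refine ⟨(-B + d) / (2 * A), 1, Or.inr one_ne_zero, ?_⟩
    field_simp
    linear_combination hd

/-- A smooth cubic contains no line. -/
lemma no_line_s13 {T : Tri} (hT : Cub T) {p q : V3} (hp : p ≠ 0) (hq : ∀ c : ℂ, q ≠ c • p)
    (h1 : T p p p = 0) (h2 : T p p q = 0) (h3 : T p q q = 0) (h4 : T q q q = 0) : False := by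
  obtain ⟨r, hr⟩ := hT.smooth p hp
  have hli : LinearIndependent ℂ ![p, q, r] := by
    apply li3
    intro a b c h
    have hc : c = 0 := by
      have := congrArg (T p p) h
      simpa [h1, h2, hr] using this
    subst hc
    rw [zero_smul, add_zero] at h
    exact ⟨(pair_indep hp hq h).1, (pair_indep hp hq h).2, rfl⟩
  obtain ⟨e, he⟩ := exists_equiv_of_li _ _ _ hli
  obtain ⟨s, t, hst, hz⟩ := exists_quad_root (T p p r) (2 * T p q r) (T q q r)
  obtain ⟨w, hw⟩ := hT.smooth (s • p + t • q) (by
    intro h0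
    have := pair_indep hp hq h0
    tauto)
  apply hw
  obtain ⟨w, rfl⟩ := e.surjective w
  rw [he]
  simp only [map_add, map_smul, LinearMap.add_apply, LinearMap.smul_apply, smul_eq_mul,
    hT.s12 q p, hT.s12 r p, hT.s12 r q, hT.s23 _ q p, hT.s23 _ r p, hT.s23 _ r q, h1, h2, h3, h4]
  linear_combination w 2 * hz

/-- Explicit polarization of the cubic `y²z - x³ - a x z² - b z³`. -/
def wT (a b : ℂ) (u v w : V3) : ℂ :=
  (u 1 * v 1 * w 2 + u 1 * v 2 * w 1 + u 2 * v 1 * w 1) / 3 - u 0 * v 0 * w 0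
    - a * (u 0 * v 2 * w 2 + u 2 * v 0 * w 2 + u 2 * v 2 * w 0) / 3 - b * (u 2 * v 2 * w 2)

/-- `T` becomes the short Weierstrass form in the coordinates `e`. -/
def NF (T : Tri) (a b : ℂ) (e : V3 ≃ₗ[ℂ] V3) : Prop :=
  ∀ u v w, T (e u) (e v) (e w) = wT a b u v w

lemma NF.disc {T : Tri} (hT : Cub T) {a b : ℂ} {e : V3 ≃ₗ[ℂ] V3} (h : NF T a b e) :
    4 * a ^ 3 + 27 * b ^ 2 ≠ 0 := by
  intro hd
  obtain ⟨x, hx1, hx2⟩ : ∃ x : ℂ, 3 * x ^ 2 + a = 0 ∧ 2 * a * x + 3 * b = 0 := by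
    by_cases ha : a = 0
    · subst ha
      have : b = 0 := by simpa using hd
      exact ⟨0, by simp, by simp [this]⟩
    · refine ⟨-(3 * b) / (2 * a), ?_, ?_⟩
      · field_simp; linear_combination hd
      · field_simp; ring
  obtain ⟨w, hw⟩ := hT.smooth (e ![x, 0, 1]) (by
    intro h0
    rw [LinearEquiv.map_eq_zero_iff] at h0
    simpa using congrFun h0 2)
  obtain ⟨w, rfl⟩ := e.surjective w
  rw [h] at hw
  apply hw
  simp [wT]
  linear_combination (-w 0 / 3) * hx1 - w 2 / 3 * hx2

lemma exists_NF {T : Tri} (hT : Cub T) {p : V3} (hp : Flex T p) :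
    ∃ a b e, NF T a b e ∧ e ![0, 1, 0] = p := by
  obtain ⟨hp0, h1, q, hq, h2, h3⟩ := hp
  have hc : T q q q ≠ 0 := fun h4 => no_line_s13 hT hp0 hq h1 h2 h3 h4
  obtain ⟨r, hr⟩ := hT.smooth p hp0
  -- scale `q`
  obtain ⟨k, hk⟩ := IsAlgClosed.exists_pow_nat_eq (-(T q q q)⁻¹) (n := 3) (by norm_num)
  obtain ⟨q1, hq1a, hq1b, hq1c⟩ : ∃ q1, T p p q1 = 0 ∧ T p q1 q1 = 0 ∧ T q1 q1 q1 = -1 := by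
    refine ⟨k • q, by simp [h2], by simp [h3], ?_⟩
    simp only [map_smul, LinearMap.smul_apply, smul_eq_mul]
    have : T q q q * (T q q q)⁻¹ = 1 := mul_inv_cancel₀ hc
    linear_combination T q q q * hk - this
  obtain ⟨r1, hr1⟩ : ∃ r1, T p p r1 = 1 / 3 := by
    refine ⟨(1 / 3 * (T p p r)⁻¹) • r, ?_⟩
    simp only [map_smul, smul_eq_mul]
    field_simp
  obtain ⟨q2, hq2a, hq2b, hq2c, hq2d⟩ : ∃ q2, T p p q2 = 0 ∧ T p q2 q2 = 0 ∧ T q2 q2 q2 = -1 ∧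
      T p q2 r1 = 0 := by
    refine ⟨q1 + (-3 * T p q1 r1) • p, ?_, ?_, ?_, ?_⟩ <;>
    simp only [map_add, map_smul, LinearMap.add_apply, LinearMap.smul_apply, smul_eq_mul,
      hT.s12 q1 p, hT.s23 _ q1 p, h1, hq1a, hq1b, hq1c, hr1] <;> ring
  obtain ⟨r2, hr2a, hr2b, hr2c⟩ : ∃ r2, T p p r2 = 1 / 3 ∧ T p q2 r2 = 0 ∧ T p r2 r2 = 0 := by
    refine ⟨r1 + (-(3 / 2) * T p r1 r1) • p, ?_, ?_, ?_⟩ <;>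
    simp only [map_add, map_smul, LinearMap.add_apply, LinearMap.smul_apply, smul_eq_mul,
      hT.s12 q2 p, hT.s23 _ q2 p, hT.s23 _ r1 p, h1, hq2a, hq2b, hq2c, hq2d, hr1] <;> ring
  obtain ⟨r3, hr3a, hr3b, hr3c, hr3d⟩ : ∃ r3, T p p r3 = 1 / 3 ∧ T p q2 r3 = 0 ∧ T p r3 r3 = 0 ∧
      T q2 q2 r3 = 0 := by
    refine ⟨r2 + (T q2 q2 r2) • q2, ?_, ?_, ?_, ?_⟩ <;>
    simp only [map_add, map_smul, LinearMap.add_apply, LinearMap.smul_apply, smul_eq_mul,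
      hT.s12 q2 p, hT.s23 _ q2 p, hT.s23 _ r2 p, hT.s23 _ r2 q2, h1, hq2a, hq2b, hq2c, hq2d,
      hr2a, hr2b, hr2c] <;> ring
  have hli : LinearIndependent ℂ ![q2, p, r3] := by
    apply li3
    intro a b c h
    have hc : c = 0 := by
      have := congrArg (T p p) h
      simpa [h1, hq2a, hr3a] using this
    subst hc
    have ha : a = 0 := by
      have := congrArg (T q2 q2) h
      simpa [hq2c, hT.s23 q2 q2 p, hT.s12 q2 p q2, hq2b] using this
    subst ha
    simpa [hp0] using h
  obtain ⟨e, he⟩ := exists_equiv_of_li _ _ _ hli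
  refine ⟨-3 * T q2 r3 r3, -T r3 r3 r3, e, ?_, by rw [he]; simp⟩
  intro u v w
  rw [he, he, he]
  simp only [map_add, map_smul, LinearMap.add_apply, LinearMap.smul_apply, smul_eq_mul,
      hT.s12 q2 p, hT.s12 r3 p, hT.s12 r3 q2, hT.s23 _ q2 p, hT.s23 _ r3 p, hT.s23 _ r3 q2,
      h1, hq2a, hq2b, hq2c, hr3a, hr3b, hr3c, hr3d, wT]
  ring

lemma tri_expand (T : V3 →ₗ[ℂ] ℂ) (v : V3) :
    T v = ∑ k, v k * T (Pi.single k 1) := by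
  rw [LinearMap.pi_apply_eq_sum_univ T v]
  refine Finset.sum_congr rfl fun i _ => ?_
  rw [smul_eq_mul]
  congr 2
  funext j
  simp [Pi.single_apply, eq_comm]

lemma exists_flex {T : Tri} (hT : Cub T) (F : MvPolynomial (Fin 3) ℂ)
    (hF : ∀ v, eval v F = T v v v) : ∃ p, Flex T p := by
  let M : Matrix (Fin 3) (Fin 3) (MvPolynomial (Fin 3) ℂ) := Matrix.of fun i j =>
    ∑ k, X k * C (T (Pi.single i 1) (Pi.single j 1) (Pi.single k 1))
  have hM : ∀ v, eval v M.det =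
      (Matrix.of fun i j : Fin 3 => T (Pi.single i 1) (Pi.single j 1) v).det := by
    intro v
    rw [RingHom.map_det]
    congr 1
    ext i j
    simp only [M, RingHom.mapMatrix_apply, Matrix.map_apply, Matrix.of_apply, map_sum, map_mul,
      eval_X, eval_C]
    rw [← tri_expand]
  obtain ⟨p, hp0, hp1, hp2⟩ := exists_common_zero F M.det (by rw [hF]; simp) (by
    rw [hM]
    simp [Matrix.det_fin_three])
  rw [hF] at hp1
  rw [hM] at hp2
  obtain ⟨q, hq0, hq⟩ := Matrix.exists_mulVec_eq_zero_iff.mpr hp2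
  have hq1 : ∀ w, T p q w = 0 := by
    have : ∀ i, T p q (Pi.single i 1) = 0 := by
      intro i
      have := congrFun hq i
      simp only [Matrix.mulVec, dotProduct, Matrix.of_apply, Pi.zero_apply] at this
      rw [hT.s23, hT.s12, tri_expand, ← this]
      refine Finset.sum_congr rfl fun j _ => ?_
      rw [mul_comm, hT.s23]
    intro w
    rw [tri_expand]
    simp [this]
  refine ⟨p, hp0, hp1, q, ?_, ?_, hq1 q⟩
  · rintro c rfl
    have hc : c ≠ 0 := by rintro rfl; simp at hq0
    obtain ⟨w, hw⟩ := hT.smooth p hp0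
    have := hq1 w
    simp [hc, hw] at this
  · rw [hT.s23, hq1]

/-- Linear automorphisms preserving the trilinear form. -/
def IsAut (T : Tri) (σ : V3 ≃ₗ[ℂ] V3) : Prop :=
  ∀ u v w, T (σ u) (σ v) (σ w) = T u v w

lemma polarize {T : Tri} (hT : Cub T) (u v w : V3) :
    T u v w = (T (u + v + w) (u + v + w) (u + v + w) - T (u + v) (u + v) (u + v)
      - T (u + w) (u + w) (u + w) - T (v + w) (v + w) (v + w)
      + T u u u + T v v v + T w w w) / 6 := by
  simp only [map_add, LinearMap.add_apply, hT.s12 v u, hT.s12 w u, hT.s12 w v, hT.s23 _ v u,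
    hT.s23 _ w u, hT.s23 _ w v]
  ring

lemma isAut_iff {T : Tri} (hT : Cub T) (σ : V3 ≃ₗ[ℂ] V3) :
    IsAut T σ ↔ ∀ v, T (σ v) (σ v) (σ v) = T v v v := by
  refine ⟨fun h v => h v v v, fun h u v w => ?_⟩
  rw [polarize hT, polarize hT u v w]
  simp only [← map_add, h]

lemma IsAut.symm {T : Tri} {σ : V3 ≃ₗ[ℂ] V3} (h : IsAut T σ) : IsAut T σ.symm := by
  intro u v w
  rw [← h]; simp

lemma IsAut.trans {T : Tri} {σ τ : V3 ≃ₗ[ℂ] V3} (h : IsAut T σ) (h' : IsAut T τ) :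
    IsAut T (σ.trans τ) := by
  intro u v w
  simp only [LinearEquiv.trans_apply]
  rw [h', h]

lemma IsAut.flex {T : Tri} {σ : V3 ≃ₗ[ℂ] V3} (h : IsAut T σ) {p : V3} (hp : Flex T p) :
    Flex T (σ p) := by
  obtain ⟨hp0, h1, q, hq, h2, h3⟩ := hp
  refine ⟨by simpa using hp0, by rw [h, h1], σ q, ?_, by rw [h, h2], by rw [h, h3]⟩
  intro c hc
  apply hq c
  apply σ.injective
  rw [hc, map_smul]

lemma Flex.smul {T : Tri} {p : V3} (hp : Flex T p) {c : ℂ} (hc : c ≠ 0) : Flex T (c • p) := by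
  obtain ⟨hp0, h1, q, hq, h2, h3⟩ := hp
  refine ⟨by simp [hp0, hc], by simp [h1], q, ?_, by simp [h2], by simp [h3]⟩
  intro d
  rw [smul_smul]
  exact hq _

lemma flex_aff {T : Tri} (hT : Cub T) {a b : ℂ} {e : V3 ≃ₗ[ℂ] V3} (h : NF T a b e) (x y : ℂ) :
    Flex T (e ![x, y, 1]) ↔
      (3 * x ^ 4 + 6 * a * x ^ 2 + 12 * b * x - a ^ 2 = 0 ∧ y ^ 2 = x ^ 3 + a * x + b) ∧ y ≠ 0 := by
  have hd := h.disc hT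
  constructor
  · rintro ⟨hp0, h1, q, hq, h2, h3⟩
    obtain ⟨q, rfl⟩ := e.surjective q
    rw [h] at h1 h2 h3
    simp [wT] at h1 h2 h3
    have hE : y ^ 2 = x ^ 3 + a * x + b := by linear_combination h1
    obtain ⟨s, hs⟩ : ∃ s, s = q 0 - q 2 * x := ⟨_, rfl⟩
    obtain ⟨t, ht⟩ : ∃ t, t = q 1 - q 2 * y := ⟨_, rfl⟩
    have e2 : 2 * y * t = (3 * x ^ 2 + a) * s := by
      rw [hs, ht]; linear_combination 3 * h2 - 3 * q 2 * h1
    have e3 : t ^ 2 = 3 * x * s ^ 2 := by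
      rw [hs, ht]; linear_combination 3 * h3 - 6 * q 2 * h2 + 3 * q 2 ^ 2 * h1
    have hs0 : s ≠ 0 := by
      rintro rfl
      have ht0 : t = 0 := by simpa using e3
      apply hq (q 2)
      rw [← map_smul]
      congr 1
      funext i
      fin_cases i
      · simp; linear_combination -hs
      · simp; linear_combination ht0 - ht
      · simp
    have hψ : 3 * x ^ 4 + 6 * a * x ^ 2 + 12 * b * x - a ^ 2 = 0 := by
      have : s ^ 2 * (3 * x ^ 4 + 6 * a * x ^ 2 + 12 * b * x - a ^ 2) = 0 := by
        linear_combination (2 * y * t + (3 * x ^ 2 + a) * s) * e2 - 4 * y ^ 2 * e3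
          - 12 * x * s ^ 2 * hE
      simpa [hs0] using this
    refine ⟨⟨hψ, hE⟩, ?_⟩
    rintro rfl
    have e4 : 3 * x ^ 2 + a = 0 := by
      have : (3 * x ^ 2 + a) * s = 0 := by rw [← e2]; ring
      simpa [hs0] using this
    apply hd
    grobner
  · rintro ⟨⟨hψ, hE⟩, hy⟩
    refine ⟨?_, ?_, e ![1, (3 * x ^ 2 + a) / (2 * y), 0], ?_, ?_, ?_⟩
    · intro h0
      rw [LinearEquiv.map_eq_zero_iff] at h0
      simpa using congrFun h0 2
    · rw [h]; simp [wT]; linear_combination hE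
    · intro c hc
      rw [← map_smul] at hc
      have := e.injective hc
      have h2 := congrFun this 2
      have h0 := congrFun this 0
      simp at h0 h2
      simp [← h2] at h0
    · rw [h]; simp [wT]; field_simp; ring
    · rw [h]; simp [wT]; field_simp; linear_combination 12 * x * (- hE) - hψ

lemma flex_cases {T : Tri} {a b : ℂ} {e : V3 ≃ₗ[ℂ] V3} (h : NF T a b e) {p : V3}
    (hp : Flex T p) : (∃ c : ℂ, c ≠ 0 ∧ p = c • e ![0, 1, 0]) ∨
      ∃ x y c : ℂ, c ≠ 0 ∧ p = c • e ![x, y, 1] ∧ Flex T (e ![x, y, 1]) := by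
  obtain ⟨v, rfl⟩ := e.surjective p
  by_cases h2 : v 2 = 0
  · left
    have h1 := hp.2.1
    rw [h] at h1
    simp [wT, h2] at h1
    have hv : e v = v 1 • e ![0, 1, 0] := by
      rw [← map_smul]; congr 1; funext i; fin_cases i <;> simp [h1, h2]
    refine ⟨v 1, ?_, hv⟩
    intro h0
    apply hp.1
    rw [hv, h0, zero_smul]
  · right
    have hv : e v = v 2 • e ![v 0 / v 2, v 1 / v 2, 1] := by
      rw [← map_smul]; congr 1; funext i; fin_cases i <;> simp <;> field_simp
    refine ⟨v 0 / v 2, v 1 / v 2, v 2, h2, hv, ?_⟩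
    have := hp.smul (inv_ne_zero h2)
    rw [hv, smul_smul, inv_mul_cancel₀ h2, one_smul] at this
    exact this

/-- Diagonal linear automorphisms. -/
def diagE (α β γ : ℂ) (hα : α ≠ 0) (hβ : β ≠ 0) (hγ : γ ≠ 0) : V3 ≃ₗ[ℂ] V3 where
  toFun v := ![α * v 0, β * v 1, γ * v 2]
  invFun v := ![α⁻¹ * v 0, β⁻¹ * v 1, γ⁻¹ * v 2]
  map_add' u v := by ext i; fin_cases i <;> simp <;> ring
  map_smul' c v := by ext i; fin_cases i <;> simp <;> ring
  left_inv v := by ext i; fin_cases i <;> simp <;> field_simp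
  right_inv v := by ext i; fin_cases i <;> simp <;> field_simp

lemma diagE_apply (α β γ : ℂ) (hα : α ≠ 0) (hβ : β ≠ 0) (hγ : γ ≠ 0) (v : V3) :
    diagE α β γ hα hβ hγ v = ![α * v 0, β * v 1, γ * v 2] := rfl

lemma exists_invol {T : Tri} (hT : Cub T) {p q : V3} (hp : Flex T p) (hq : Flex T q)
    (hpq : ∀ c : ℂ, q ≠ c • p) :
    ∃ σ, IsAut T σ ∧ σ p = -p ∧ ∃ μ : ℂ, μ ≠ 0 ∧ σ q = q + μ • p := by
  obtain ⟨a, b, e, h, he⟩ := exists_NF hT hp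
  have h1 : (1 : ℂ) ≠ 0 := one_ne_zero
  have hm1 : (-1 : ℂ) ≠ 0 := by norm_num
  refine ⟨(e.symm.trans (diagE 1 (-1) 1 h1 hm1 h1)).trans e, ?_, ?_, ?_⟩
  · intro u v w
    obtain ⟨u, rfl⟩ := e.surjective u
    obtain ⟨v, rfl⟩ := e.surjective v
    obtain ⟨w, rfl⟩ := e.surjective w
    simp only [LinearEquiv.trans_apply, LinearEquiv.symm_apply_apply, diagE_apply]
    rw [h, h]
    simp [wT]
  · rw [← he]
    simp only [LinearEquiv.trans_apply, LinearEquiv.symm_apply_apply, diagE_apply, ← map_neg]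
    congr 1; funext i; fin_cases i <;> simp
  · rcases flex_cases h hq with ⟨c, hc, h2⟩ | ⟨x, y, c, hc, h2, h3⟩
    · rw [he] at h2
      exact absurd h2 (hpq c)
    · have hy := ((flex_aff hT h x y).mp h3).2
      refine ⟨-(2 * c * y), by simp [hc, hy], ?_⟩
      rw [h2, ← he]
      simp only [map_smul, LinearEquiv.trans_apply, LinearEquiv.symm_apply_apply, diagE_apply]
      rw [← map_smul, ← map_smul, ← map_smul, ← map_add]
      congr 1; funext i; fin_cases i <;> simp; ring

/-- The automorphism group acts transitively on the flexes. -/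
lemma flex_transitive {T : Tri} (hT : Cub T) {p q : V3} (hp : Flex T p) (hq : Flex T q) :
    ∃ σ, IsAut T σ ∧ ∃ c : ℂ, σ p = c • q := by
  by_cases hpq : ∃ c : ℂ, q = c • p
  · obtain ⟨c, rfl⟩ := hpq
    have hc : c ≠ 0 := by rintro rfl; exact hq.1 (zero_smul _ _)
    refine ⟨LinearEquiv.refl _ _, fun _ _ _ => rfl, c⁻¹, ?_⟩
    rw [smul_smul, inv_mul_cancel₀ hc, one_smul]; rfl
  push Not at hpq
  obtain ⟨σ, hσ, hσp, μ, hμ, hσq⟩ := exists_invol hT hp hq hpq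
  have hr : Flex T (q + μ • p) := hσq ▸ hσ.flex hq
  obtain ⟨τ, hτ, hτr, ν, hν, hτp⟩ := exists_invol hT hr hp (by
    intro c hc
    have : (1 - c * μ) • p + (-c) • q = 0 := by
      rw [sub_smul, one_smul]; nth_rewrite 1 [hc]; module
    obtain ⟨h1, h2⟩ := pair_indep hp.1 hpq this
    have : c = 0 := by simpa using h2
    simp [this] at h1)
  refine ⟨τ, hτ, ν, ?_⟩
  have hs := (hτ.flex hp).2.1
  have hr1 := hr.2.1
  have hp1 := hp.2.1
  have hq1 := hq.2.1
  rw [hτp] at hs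
  simp only [map_add, map_smul, LinearMap.add_apply, LinearMap.smul_apply, smul_eq_mul,
    hT.s12 q p, hT.s23 _ q p, hp1, hq1] at hs hr1
  have h1 : T p q q = - μ * T p p q := by
    have : 3 * μ * (T p q q + μ * T p p q) = 0 := by linear_combination hr1
    have := (mul_eq_zero.mp this).resolve_left (by simp [hμ])
    linear_combination this
  have h2 : T p p q ≠ 0 := by
    intro h2
    rw [h2, mul_zero] at h1
    exact no_line_s13 hT hp.1 hpq hp1 h2 h1 hq1
  have h3 : 1 + ν * μ = 0 := by
    rw [h1] at hs
    have : (3 * ν * T p p q) * (1 + ν * μ) = 0 := by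
      linear_combination hs
    exact (mul_eq_zero.mp this).resolve_left (by simp [hν, h2])
  rw [hτp, smul_add, smul_smul]
  have : p + (ν • q + (ν * μ) • p) = (1 + ν * μ) • p + ν • q := by module
  rw [this, h3]; simp

open Polynomial in
lemma psi_roots (a b : ℂ) (hd : 4 * a ^ 3 + 27 * b ^ 2 ≠ 0) :
    ∃ r : Fin 4 → ℂ, Function.Injective r ∧
      ∀ x, 3 * x ^ 4 + 6 * a * x ^ 2 + 12 * b * x - a ^ 2 = 0 ↔ ∃ i, x = r i := by
  obtain ⟨d, hd'⟩ : ∃ d, d = -a ^ 2 := ⟨_, rfl⟩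
  set P : ℂ[X] := Polynomial.C 3 * Polynomial.X ^ 4 + Polynomial.C (6 * a) * Polynomial.X ^ 2
    + Polynomial.C (12 * b) * Polynomial.X + Polynomial.C d with hP
  have hdeg : P.natDegree = 4 := by rw [hP]; compute_degree!
  have hP0 : P ≠ 0 := by rintro h; rw [h] at hdeg; simp at hdeg
  have hsep : P.Separable := by
    rw [Polynomial.Separable, Polynomial.isCoprime_iff_aeval_ne_zero_of_isAlgClosed ℂ ℂ]
    intro x
    by_contra! hx
    obtain ⟨h1, h2⟩ := hx
    simp [hP] at h1 h2
    clear_value P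
    clear hdeg hP0 hP
    rw [hd'] at h1
    apply hd
    grobner
  have hcard : P.roots.toFinset.card = 4 := by
    rw [Multiset.toFinset_card_of_nodup (Polynomial.nodup_roots hsep), ← hdeg]
    exact Polynomial.splits_iff_card_roots.mp (IsAlgClosed.splits P)
  let f := P.roots.toFinset.equivFinOfCardEq hcard
  refine ⟨fun i => (f.symm i).1, fun i j hij => f.symm.injective (Subtype.ext hij), fun x => ?_⟩
  have hx : 3 * x ^ 4 + 6 * a * x ^ 2 + 12 * b * x - a ^ 2 = 0 ↔ x ∈ P.roots.toFinset := by
    rw [Multiset.mem_toFinset, Polynomial.mem_roots hP0, Polynomial.IsRoot.def]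
    simp [hP, hd', sub_eq_add_neg]
  rw [hx]
  constructor
  · intro h
    exact ⟨f ⟨x, h⟩, by simp⟩
  · rintro ⟨i, rfl⟩
    exact (f.symm i).2

/-- There are exactly nine flexes. -/
lemma nine_flexes {T : Tri} (hT : Cub T) {a b : ℂ} {e : V3 ≃ₗ[ℂ] V3} (h : NF T a b e) :
    ∃ P : Fin 9 → V3, (∀ i, Flex T (P i)) ∧ (∀ i j, ∀ c : ℂ, P i = c • P j → i = j) ∧
      ∀ p, Flex T p → ∃ i, ∃ c : ℂ, c ≠ 0 ∧ p = c • P i := by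
  have hd := h.disc hT
  obtain ⟨r, hr, hr'⟩ := psi_roots a b hd
  choose s hs using fun i => IsAlgClosed.exists_pow_nat_eq (r i ^ 3 + a * r i + b)
    (n := 2) (by norm_num)
  have hs0 : ∀ i, s i ≠ 0 := by
    intro i h0
    have h1 := (hr' (r i)).mpr ⟨i, rfl⟩
    have h2 := hs i
    rw [h0] at h2
    apply hd
    grobner
  have hO : Flex T (e ![0, 1, 0]) := by
    refine ⟨?_, by rw [h]; simp [wT], e ![1, 0, 0], ?_, by rw [h]; simp [wT],
      by rw [h]; simp [wT]⟩
    · intro h0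
      rw [LinearEquiv.map_eq_zero_iff] at h0
      simpa using congrFun h0 1
    · intro c hc
      rw [← map_smul] at hc
      simpa using congrFun (e.injective hc) 0
  let Q : Option (Fin 4 × Bool) → V3 := fun o => match o with
    | none => e ![0, 1, 0]
    | some (i, b) => e ![r i, if b then s i else -s i, 1]
  have hQ : ∀ o, Flex T (Q o) := by
    rintro (_ | ⟨i, _ | _⟩)
    · exact hO
    · refine (flex_aff hT h _ _).mpr ⟨⟨(hr' (r i)).mpr ⟨i, rfl⟩, ?_⟩, ?_⟩
      · simp [hs]
      · simp [hs0]
    · refine (flex_aff hT h _ _).mpr ⟨⟨(hr' (r i)).mpr ⟨i, rfl⟩, ?_⟩, ?_⟩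
      · simp [hs]
      · simp [hs0]
  have hQi : ∀ o o', ∀ c : ℂ, Q o = c • Q o' → o = o' := by
    rintro (_ | ⟨i, b1⟩) (_ | ⟨j, b2⟩) c hc
    · rfl
    · simp only [Q] at hc
      rw [← map_smul] at hc
      have := e.injective hc
      have h2 := congrFun this 2
      have h1 := congrFun this 1
      simp at h1 h2
      simp [← h2] at h1
    · simp only [Q] at hc
      rw [← map_smul] at hc
      have := e.injective hc
      have h2 := congrFun this 2
      simp at h2
    · simp only [Q] at hc
      rw [← map_smul] at hc
      have := e.injective hc
      have h2 := congrFun this 2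
      have h1 := congrFun this 1
      have h0 := congrFun this 0
      simp at h0 h1 h2
      rw [← h2] at h0 h1
      rw [one_mul] at h0 h1
      have hij := hr h0
      subst hij
      have h3 : (2 : ℂ) * s i ≠ 0 := by simp [hs0]
      have : b1 = b2 := by
        cases b1 <;> cases b2 <;> simp at h1 ⊢
        · exact h3 (by linear_combination -h1)
        · exact h3 (by linear_combination h1)
      rw [this]
  have hQs : ∀ p, Flex T p → ∃ i, ∃ c : ℂ, c ≠ 0 ∧ p = c • Q i := by
    intro p hp
    rcases flex_cases h hp with ⟨c, hc, h2⟩ | ⟨x, y, c, hc, h2, h3⟩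
    · exact ⟨none, c, hc, h2⟩
    · obtain ⟨⟨h4, h5⟩, h6⟩ := (flex_aff hT h x y).mp h3
      obtain ⟨i, rfl⟩ := (hr' x).mp h4
      rw [← hs i, sq_eq_sq_iff_eq_or_eq_neg] at h5
      rcases h5 with rfl | rfl
      · exact ⟨some (i, true), c, hc, by simpa [Q] using h2⟩
      · exact ⟨some (i, false), c, hc, by simpa [Q] using h2⟩
  let f : Fin 9 ≃ Option (Fin 4 × Bool) := (Fintype.equivFinOfCardEq (by simp)).symm
  refine ⟨fun i => Q (f i), fun i => hQ _, fun i j c hc => f.injective (hQi _ _ c hc), ?_⟩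
  intro p hp
  obtain ⟨o, c, hc, h1⟩ := hQs p hp
  exact ⟨f.symm o, c, hc, by simpa using h1⟩

lemma card_roots_one (n : ℕ) (hn : 0 < n) : Nat.card {z : ℂ // z ^ n = 1} = n := by
  have h := (Complex.isPrimitiveRoot_exp n hn.ne').card_nthRootsFinset
  refine (Nat.subtype_card (p := fun z : ℂ => z ^ n = 1) _ ?_).trans h
  intro x
  rw [Polynomial.mem_nthRootsFinset hn]

/-- Parameters of the stabilizer of the flex at infinity. -/
def Zset (a b : ℂ) : Type :=
  {z : ℂ × ℂ // z.2 ≠ 0 ∧ z.1 ^ 3 = 1 ∧ a * z.1 = a * z.2 ^ 4 ∧ b = b * z.2 ^ 6}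

lemma card_Z_gen (a b : ℂ) (ha : a ≠ 0) (hb : b ≠ 0) : Nat.card (Zset a b) = 6 := by
  rw [← card_roots_one 6 (by norm_num)]
  refine Nat.card_congr (Equiv.mk (fun z => ⟨z.1.2, ?_⟩) (fun z => ⟨(z.1 ^ 4, z.1), ?_⟩) ?_ ?_)
  · obtain ⟨h1, h2, h3, h4⟩ := z.2
    exact mul_left_cancel₀ hb (by rw [← h4, mul_one])
  · have h := z.2
    refine ⟨?_, ?_, rfl, ?_⟩
    · intro h0
      simp only at h0
      rw [h0] at h; simp at h
    · simp only
      calc (z.1 ^ 4) ^ 3 = (z.1 ^ 6) ^ 2 := by ring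
        _ = 1 := by rw [h]; norm_num
    · simp [h]
  · intro z
    obtain ⟨h1, h2, h3, h4⟩ := z.2
    apply Subtype.ext
    exact Prod.ext (mul_left_cancel₀ ha h3).symm rfl
  · intro z; rfl

lemma card_Z_1728 (a b : ℂ) (ha : a ≠ 0) (hb : b = 0) : Nat.card (Zset a b) = 12 := by
  rw [← card_roots_one 12 (by norm_num)]
  refine Nat.card_congr (Equiv.mk (fun z => ⟨z.1.2, ?_⟩) (fun z => ⟨(z.1 ^ 4, z.1), ?_⟩) ?_ ?_)
  · obtain ⟨h1, h2, h3, h4⟩ := z.2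
    have := mul_left_cancel₀ ha h3
    calc z.1.2 ^ 12 = (z.1.2 ^ 4) ^ 3 := by ring
      _ = 1 := by rw [← this, h2]
  · have h := z.2
    refine ⟨?_, ?_, rfl, ?_⟩
    · intro h0
      simp only at h0
      rw [h0] at h; simp at h
    · simp only
      calc (z.1 ^ 4) ^ 3 = (z.1 ^ 12) := by ring
        _ = 1 := by rw [h]
    · simp [hb]
  · intro z
    obtain ⟨h1, h2, h3, h4⟩ := z.2
    apply Subtype.ext
    exact Prod.ext (mul_left_cancel₀ ha h3).symm rfl
  · intro z; rfl

lemma card_Z_0 (a b : ℂ) (ha : a = 0) (hb : b ≠ 0) : Nat.card (Zset a b) = 18 := by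
  have : 18 = Nat.card ({z : ℂ // z ^ 3 = 1} × {z : ℂ // z ^ 6 = 1}) := by
    rw [Nat.card_prod, card_roots_one 3 (by norm_num), card_roots_one 6 (by norm_num)]
  rw [this]
  refine Nat.card_congr (Equiv.mk (fun z => (⟨z.1.1, z.2.2.1⟩, ⟨z.1.2, ?_⟩))
    (fun z => ⟨(z.1, z.2), ?_⟩) ?_ ?_)
  · obtain ⟨h1, h2, h3, h4⟩ := z.2
    exact mul_left_cancel₀ hb (by rw [← h4, mul_one])
  · have h := z.2.2
    refine ⟨?_, z.1.2, ?_, ?_⟩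
    · intro h0
      simp only at h0
      rw [h0] at h; simp at h
    · simp [ha]
    · simp [h]
  · intro z; rfl
  · intro z; rfl

/-- The stabilizer of the flex at infinity. -/
def Stab (T : Tri) (p : V3) : Type := {σ : V3 ≃ₗ[ℂ] V3 // IsAut T σ ∧ ∃ c : ℂ, σ p = c • p}

lemma card_stab {T : Tri} {a b : ℂ} {e : V3 ≃ₗ[ℂ] V3} (h : NF T a b e) :
    Nat.card (Stab T (e ![0, 1, 0])) = Nat.card (Zset a b) := by
  symm
  have hα : ∀ z : Zset a b, z.1.1 ≠ 0 := by
    intro z h0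
    have := z.2.2.1
    rw [h0] at this; simp at this
  have hγ : ∀ z : Zset a b, (z.1.2 ^ 2)⁻¹ ≠ 0 := fun z => inv_ne_zero (pow_ne_zero _ z.2.1)
  let f : Zset a b → Stab T (e ![0, 1, 0]) := fun z =>
    ⟨(e.symm.trans (diagE z.1.1 z.1.2 (z.1.2 ^ 2)⁻¹ (hα z) z.2.1 (hγ z))).trans e, by
      obtain ⟨h1, h2, h3, h4⟩ := z.2
      constructor
      · intro u v w
        obtain ⟨u, rfl⟩ := e.surjective u
        obtain ⟨v, rfl⟩ := e.surjective v
        obtain ⟨w, rfl⟩ := e.surjective w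
        simp only [LinearEquiv.trans_apply, LinearEquiv.symm_apply_apply, diagE_apply]
        rw [h, h]
        simp [wT]
        field_simp
        linear_combination (-3 * z.1.2 ^ 6 * u 0 * v 0 * w 0) * h2
          - z.1.2 ^ 2 * (u 0 * v 2 * w 2 + u 2 * v 0 * w 2 + u 2 * v 2 * w 0) * h3
          - 3 * (u 2 * v 2 * w 2) * h4
      · refine ⟨z.1.2, ?_⟩
        simp only [LinearEquiv.trans_apply, LinearEquiv.symm_apply_apply, diagE_apply, ← map_smul]
        congr 1; funext i; fin_cases i <;> simp⟩
  refine Nat.card_congr (Equiv.ofBijective f ⟨?_, ?_⟩)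
  · intro z z' hz
    have hz' : ∀ v, e (diagE z.1.1 z.1.2 (z.1.2 ^ 2)⁻¹ (hα z) z.2.1 (hγ z) v) =
        e (diagE z'.1.1 z'.1.2 (z'.1.2 ^ 2)⁻¹ (hα z') z'.2.1 (hγ z') v) := by
      intro v
      have := congrArg (fun s : Stab T (e ![0, 1, 0]) => s.1 (e v)) hz
      simpa [f] using this
    have := e.injective (hz' ![1, 1, 1])
    simp only [diagE_apply] at this
    apply Subtype.ext
    refine Prod.ext ?_ ?_
    · simpa using congrFun this 0
    · simpa using congrFun this 1
  · rintro ⟨σ, hσ, c, hc⟩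
    set g := (e.trans σ).trans e.symm with hg
    have hge : ∀ v, e (g v) = σ (e v) := by intro v; simp [hg]
    have hgw : ∀ u v w, wT a b (g u) (g v) (g w) = wT a b u v w := by
      intro u v w
      rw [← h, ← h, hge, hge, hge, hσ]
    have hB : g ![0, 1, 0] = ![0, c, 0] := by
      apply e.injective
      rw [hge, hc, ← map_smul]
      congr 1; funext i; fin_cases i <;> simp
    obtain ⟨A, hA⟩ : ∃ A, A = g ![1, 0, 0] := ⟨_, rfl⟩
    obtain ⟨D, hD⟩ : ∃ D, D = g ![0, 0, 1] := ⟨_, rfl⟩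
    have hgv : ∀ v, g v = v 0 • A + v 1 • ![0, c, 0] + v 2 • D := by
      intro v
      rw [hA, hD, ← hB, ← map_smul, ← map_smul, ← map_smul, ← map_add, ← map_add]
      congr 1; funext i; fin_cases i <;> simp
    have k1 := hgw ![0, 1, 0] ![0, 1, 0] ![1, 0, 0]
    have k2 := hgw ![0, 1, 0] ![0, 1, 0] ![0, 0, 1]
    have k3 := hgw ![1, 0, 0] ![1, 0, 0] ![1, 0, 0]
    have k4 := hgw ![1, 0, 0] ![0, 1, 0] ![0, 0, 1]
    have k5 := hgw ![0, 1, 0] ![0, 0, 1] ![0, 0, 1]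
    have k6 := hgw ![1, 0, 0] ![1, 0, 0] ![0, 0, 1]
    have k7 := hgw ![1, 0, 0] ![0, 0, 1] ![0, 0, 1]
    have k8 := hgw ![0, 0, 1] ![0, 0, 1] ![0, 0, 1]
    rw [hB, ← hA] at k1
    rw [hB, ← hD] at k2
    rw [← hA] at k3
    rw [hB, ← hA, ← hD] at k4
    rw [hB, ← hD] at k5
    rw [← hA, ← hD] at k6 k7
    rw [← hD] at k8
    simp [wT] at k1 k2 k3 k4 k5 k6 k7 k8
    have hcD : c ^ 2 * D 2 = 1 := by linear_combination 3 * k2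
    have hc0 : c ≠ 0 := by rintro rfl; simp at hcD
    have hD20 : D 2 ≠ 0 := by intro h0; rw [h0] at hcD; simp at hcD
    have hA2 : A 2 = 0 := by simpa [hc0] using k1
    simp [hA2, hc0, hD20] at k3 k4
    have hA03 : A 0 ^ 3 = 1 := by linear_combination k3
    have hA00 : A 0 ≠ 0 := by intro h0; rw [h0] at hA03; simp at hA03
    have hD1 : D 1 = 0 := by
      have : 2 * (c * D 2) * D 1 = 0 := by linear_combination k5
      simpa [hc0, hD20] using this
    have hD0 : D 0 = 0 := by
      simpa [k4, hA2, hA00] using k6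
    have hD2 : D 2 = (c ^ 2)⁻¹ := by
      field_simp; linear_combination hcD
    simp [k4, hA2, hD1, hD0] at k7 k8
    refine ⟨⟨(A 0, c), hc0, hA03, ?_, ?_⟩, ?_⟩
    · simp only
      linear_combination a * A 0 * (- (c ^ 2 * D 2 + 1)) * hcD + c ^ 4 * k7
    · simp only
      linear_combination b * (- (c ^ 4 * D 2 ^ 2 + c ^ 2 * D 2 + 1)) * hcD + c ^ 6 * k8
    · apply Subtype.ext
      apply LinearEquiv.ext
      intro v
      obtain ⟨v, rfl⟩ := e.surjective v
      rw [← hge, hgv]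
      simp only [f, LinearEquiv.trans_apply, LinearEquiv.symm_apply_apply, diagE_apply]
      congr 1
      funext i; fin_cases i
      · simp [hD0, mul_comm, Matrix.vecHead, Matrix.vecTail]
      · simp [k4, hD1, mul_comm, Matrix.vecHead, Matrix.vecTail]
      · simp [hA2, hD2, mul_comm, Matrix.vecHead, Matrix.vecTail]

lemma card_aut {T : Tri} (hT : Cub T) {a b : ℂ} {e : V3 ≃ₗ[ℂ] V3} (h : NF T a b e) :
    Nat.card {σ : V3 ≃ₗ[ℂ] V3 // IsAut T σ} = 9 * Nat.card (Zset a b) := by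
  obtain ⟨P, hP1, hP2, hP3⟩ := nine_flexes hT h
  rw [← card_stab h]
  set O := e ![0, 1, 0] with hO
  have hOf : Flex T O := by
    refine ⟨?_, by rw [h]; simp [wT], e ![1, 0, 0], ?_, by rw [h]; simp [wT],
      by rw [h]; simp [wT]⟩
    · intro h0
      rw [hO, LinearEquiv.map_eq_zero_iff] at h0
      simpa using congrFun h0 1
    · intro c hc
      rw [hO, ← map_smul] at hc
      simpa using congrFun (e.injective hc) 0
  choose τ hτ c hc using fun i => flex_transitive hT hOf (hP1 i)
  have hc0 : ∀ i, c i ≠ 0 := by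
    intro i h0
    have := hc i
    rw [h0, zero_smul, LinearEquiv.map_eq_zero_iff] at this
    exact hOf.1 this
  let f : Fin 9 × Stab T O → {σ : V3 ≃ₗ[ℂ] V3 // IsAut T σ} := fun x =>
    ⟨x.2.1.trans (τ x.1), x.2.2.1.trans (hτ x.1)⟩
  have hf : Function.Bijective f := by
    constructor
    · rintro ⟨i, σ, hσ, d, hd⟩ ⟨j, σ', hσ', d', hd'⟩ hij
      have hij' : ∀ v, τ i (σ v) = τ j (σ' v) := by
        intro v
        have := congrArg (fun s => s.1 v) hij
        simpa [f] using this
      have hd0 : d ≠ 0 := by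
        rintro rfl
        rw [zero_smul, LinearEquiv.map_eq_zero_iff] at hd
        exact hOf.1 hd
      have h1 := hij' O
      rw [hd, hd', map_smul, map_smul, hc, hc, smul_smul, smul_smul] at h1
      have : i = j := by
        apply hP2 i j ((d * c i)⁻¹ * (d' * c j))
        rw [mul_smul, ← h1, smul_smul, inv_mul_cancel₀ (mul_ne_zero hd0 (hc0 i)), one_smul]
      subst this
      have : σ = σ' := LinearEquiv.ext fun v => (τ i).injective (hij' v)
      subst this
      rfl
    · rintro ⟨g, hg⟩
      obtain ⟨i, d, hd0, hd⟩ := hP3 (g O) (hg.flex hOf)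
      refine ⟨(i, ⟨g.trans (τ i).symm, hg.trans (hτ i).symm, d * (c i)⁻¹, ?_⟩), ?_⟩
      · rw [LinearEquiv.trans_apply, LinearEquiv.symm_apply_eq, map_smul, hc, hd, smul_smul,
          mul_assoc, inv_mul_cancel₀ (hc0 i), mul_one]
      · apply Subtype.ext
        apply LinearEquiv.ext
        intro v
        simp [f]
  rw [← Nat.card_congr (Equiv.ofBijective f hf), Nat.card_prod]
  simp

/-- Planes in `T(x,x,x) = T(y,y,y)`, in the coordinates `V3 × V3`. -/
def PlS (T : Tri) : Set (Submodule ℂ (V3 × V3)) :=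
  {W | Module.finrank ℂ W = 3 ∧ ∀ z ∈ W, T z.1 z.1 z.1 = T z.2 z.2 z.2}

lemma PlS.pol {T : Tri} (hT : Cub T) {W : Submodule ℂ (V3 × V3)} (hW : W ∈ PlS T)
    {u v w : V3 × V3} (hu : u ∈ W) (hv : v ∈ W) (hw : w ∈ W) :
    T u.1 v.1 w.1 = T u.2 v.2 w.2 := by
  rw [polarize hT, polarize hT u.2 v.2 w.2]
  have h := hW.2
  have h1 := h _ (W.add_mem (W.add_mem hu hv) hw)
  have h2 := h _ (W.add_mem hu hv)
  have h3 := h _ (W.add_mem hu hw)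
  have h4 := h _ (W.add_mem hv hw)
  simp only [Prod.fst_add, Prod.snd_add] at h1 h2 h3 h4
  rw [h1, h2, h3, h4, h _ hu, h _ hv, h _ hw]

lemma bij_of_inj {W : Submodule ℂ (V3 × V3)} (hW : Module.finrank ℂ W = 3)
    (f : W →ₗ[ℂ] V3) (hf : Function.Injective f) : Function.Bijective f :=
  ⟨hf, (LinearMap.injective_iff_surjective_of_finrank_eq_finrank (by simp [hW])).1 hf⟩

/-- Graph planes. -/
lemma card_graphs {T : Tri} (hT : Cub T) :
    Nat.card {W : Submodule ℂ (V3 × V3) // W ∈ PlS T ∧ ∀ y, ((0 : V3), y) ∈ W → y = 0} =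
      Nat.card {σ : V3 ≃ₗ[ℂ] V3 // IsAut T σ} := by
  symm
  have hfr : ∀ σ : V3 ≃ₗ[ℂ] V3, Module.finrank ℂ (LinearMap.graph σ.toLinearMap) = 3 := by
    intro σ
    rw [LinearMap.graph_eq_range_prod, LinearMap.finrank_range_of_inj]
    · simp
    · intro x y hxy
      simpa using congrArg Prod.fst hxy
  let f : {σ : V3 ≃ₗ[ℂ] V3 // IsAut T σ} →
      {W : Submodule ℂ (V3 × V3) // W ∈ PlS T ∧ ∀ y, ((0 : V3), y) ∈ W → y = 0} :=
    fun σ => ⟨LinearMap.graph σ.1.toLinearMap, ⟨hfr _, by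
      intro z hz
      rw [LinearMap.mem_graph_iff] at hz
      rw [hz]
      exact (σ.2 _ _ _).symm⟩, by
      intro y hy
      rw [LinearMap.mem_graph_iff] at hy
      simpa using hy⟩
  refine Nat.card_congr (Equiv.ofBijective f ⟨?_, ?_⟩)
  · intro σ τ h
    have h' : LinearMap.graph σ.1.toLinearMap = LinearMap.graph τ.1.toLinearMap :=
      congrArg Subtype.val h
    apply Subtype.ext
    apply LinearEquiv.ext
    intro v
    have : (v, σ.1 v) ∈ LinearMap.graph τ.1.toLinearMap := by
      rw [← h', LinearMap.mem_graph_iff]; rfl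
    rw [LinearMap.mem_graph_iff] at this
    exact this
  · rintro ⟨W, hW, hK⟩
    have hinj : Function.Injective ((LinearMap.fst ℂ V3 V3).comp W.subtype) := by
      rw [injective_iff_map_eq_zero]
      rintro ⟨⟨x, y⟩, hz⟩ h0
      have hx : x = 0 := h0
      subst hx
      have := hK y hz
      subst this
      rfl
    obtain ⟨g, hg⟩ := Submodule.exists_eq_graph (G := W) (bij_of_inj hW.1 _ hinj)
    have hmem : ∀ x, (x, g x) ∈ W := by
      intro x; rw [hg, LinearMap.mem_graph_iff]
    have hpol : ∀ u v w, T (g u) (g v) (g w) = T u v w := fun u v w =>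
      (PlS.pol hT hW (hmem u) (hmem v) (hmem w)).symm
    have hginj : Function.Injective g := by
      rw [injective_iff_map_eq_zero]
      intro x hx
      by_contra hx0
      obtain ⟨w, hw⟩ := hT.smooth x hx0
      apply hw
      rw [← hpol, hx]
      simp
    refine ⟨⟨LinearEquiv.ofInjectiveEndo g hginj, ?_⟩, ?_⟩
    · intro u v w
      simpa using hpol u v w
    · apply Subtype.ext
      show LinearMap.graph _ = W
      rw [hg]
      congr 1

/-- Flex flags with a normalized second vector. -/
lemma exists_Q {T : Tri} (hT : Cub T) {p : V3} (hp : Flex T p) :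
    ∃ q, (∀ c : ℂ, q ≠ c • p) ∧ T p p q = 0 ∧ T p q q = 0 ∧ T q q q = 1 := by
  obtain ⟨hp0, h1, q, hq, h2, h3⟩ := hp
  have h4 : T q q q ≠ 0 := fun h4 => no_line_s13 hT hp0 hq h1 h2 h3 h4
  obtain ⟨s, hs⟩ := IsAlgClosed.exists_pow_nat_eq (T q q q)⁻¹ (n := 3) (by norm_num)
  have hs0 : s ≠ 0 := by
    rintro rfl
    simp at hs
    exact h4 hs.symm
  refine ⟨s • q, ?_, by simp [h2], by simp [h3], ?_⟩
  · intro c hc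
    apply hq (s⁻¹ * c)
    rw [mul_smul, ← hc, smul_smul, inv_mul_cancel₀ hs0, one_smul]
  · simp only [map_smul, LinearMap.smul_apply, smul_eq_mul]
    calc _ = s ^ 3 * T q q q := by ring
      _ = 1 := by rw [hs, inv_mul_cancel₀ h4]

lemma tangent_span {T : Tri} (hT : Cub T) {p q x : V3} (hp : p ≠ 0) (hp1 : T p p p = 0)
    (hq : ∀ c : ℂ, q ≠ c • p) (h2 : T p p q = 0) (hx : T p p x = 0) :
    ∃ a b : ℂ, x = a • p + b • q := by
  obtain ⟨r, hr⟩ := hT.smooth p hp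
  have hli : LinearIndependent ℂ ![p, q, r] := by
    apply li3
    intro a b c h
    have hc : c = 0 := by
      have := congrArg (T p p) h
      simp only [map_add, map_smul, hp1, h2, map_zero, smul_eq_mul, mul_zero, zero_add] at this
      simpa [hr] using this
    subst hc
    rw [zero_smul, add_zero] at h
    have := pair_indep hp hq h
    exact ⟨this.1, this.2, rfl⟩
  obtain ⟨e, he⟩ := exists_equiv_of_li _ _ _ hli
  obtain ⟨v, rfl⟩ := e.surjective x
  rw [he] at hx ⊢
  simp only [map_add, map_smul, hp1, h2, map_zero, smul_eq_mul, mul_zero, zero_add] at hx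
  have : v 2 = 0 := by simpa [hr] using hx
  exact ⟨v 0, v 1, by rw [this]; simp⟩

/-- Parametrization of a rank two plane. -/
def flMap (p q p' q' : V3) : V3 →ₗ[ℂ] V3 × V3 where
  toFun v := (v 0 • p + v 2 • q, v 1 • p' + v 2 • q')
  map_add' u v := by
    ext i <;> simp <;> ring
  map_smul' c v := by
    ext i <;> simp <;> ring

lemma mem_flMap {p q p' q' : V3} {z : V3 × V3} : z ∈ LinearMap.range (flMap p q p' q') ↔
    ∃ a b c : ℂ, z.1 = a • p + c • q ∧ z.2 = b • p' + c • q' := by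
  constructor
  · rintro ⟨v, rfl⟩
    exact ⟨v 0, v 1, v 2, rfl, rfl⟩
  · rintro ⟨a, b, c, h1, h2⟩
    exact ⟨![a, b, c], by ext1 <;> simp [flMap, h1, h2]⟩

lemma finrank_flMap {p q p' q' : V3} (hp : p ≠ 0) (hq : ∀ c : ℂ, q ≠ c • p) (hp' : p' ≠ 0) :
    Module.finrank ℂ (LinearMap.range (flMap p q p' q')) = 3 := by
  rw [LinearMap.finrank_range_of_inj]
  · simp
  · rw [injective_iff_map_eq_zero]
    intro v hv
    have h1 : v 0 • p + v 2 • q = 0 := congrArg Prod.fst hv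
    have h2 : v 1 • p' + v 2 • q' = 0 := congrArg Prod.snd hv
    obtain ⟨h0, h3⟩ := pair_indep hp hq h1
    rw [h3, zero_smul, add_zero, smul_eq_zero, or_iff_left hp'] at h2
    funext i; fin_cases i <;> assumption

/-- The classification of the planes which are not graphs. -/
lemma rank2_class {T : Tri} (hT : Cub T) {W : Submodule ℂ (V3 × V3)} (hW : W ∈ PlS T)
    {k : V3} (hk0 : k ≠ 0) (hk : ((0 : V3), k) ∈ W) :
    ∃ h q1 q2 : V3, h ≠ 0 ∧ (h, (0 : V3)) ∈ W ∧ (q1, q2) ∈ W ∧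
      (∀ c : ℂ, q1 ≠ c • h) ∧ (∀ c : ℂ, q2 ≠ c • k) := by
  have hh : ∃ h : V3, h ≠ 0 ∧ (h, (0 : V3)) ∈ W := by
    by_contra hcon
    push Not at hcon
    have hinj : Function.Injective ((LinearMap.snd ℂ V3 V3).comp W.subtype) := by
      rw [injective_iff_map_eq_zero]
      rintro ⟨⟨x, y⟩, hz⟩ h0
      have hy : y = 0 := h0
      subst hy
      have : x = 0 := by
        by_contra hx
        exact hcon x hx hz
      subst this
      rfl
    obtain ⟨w, hw⟩ := hT.smooth k hk0
    obtain ⟨⟨⟨x, y⟩, hz⟩, hzw⟩ := (bij_of_inj hW.1 _ hinj).2 w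
    have hy : y = w := hzw
    subst hy
    apply hw
    have := PlS.pol hT hW hk hk hz
    simpa using this.symm
  obtain ⟨h, hh0, hh⟩ := hh
  have hz1 : ∀ x, (x, (0 : V3)) ∈ W → ∃ c : ℂ, x = c • h := by
    intro x hx
    by_contra hcon
    push Not at hcon
    refine no_line_s13 hT hh0 hcon ?_ ?_ ?_ ?_
    · simpa using PlS.pol hT hW hh hh hh
    · simpa using PlS.pol hT hW hh hh hx
    · simpa using PlS.pol hT hW hh hx hx
    · simpa using PlS.pol hT hW hx hx hx
  have hz2 : ∀ x, ((0 : V3), x) ∈ W → ∃ c : ℂ, x = c • k := by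
    intro x hx
    by_contra hcon
    push Not at hcon
    refine no_line_s13 hT hk0 hcon ?_ ?_ ?_ ?_
    · simpa using (PlS.pol hT hW hk hk hk).symm
    · simpa using (PlS.pol hT hW hk hk hx).symm
    · simpa using (PlS.pol hT hW hk hx hx).symm
    · simpa using (PlS.pol hT hW hx hx hx).symm
  have hex : ∃ z ∈ W, z ∉ Submodule.span ℂ ({(h, (0 : V3)), ((0 : V3), k)} : Set (V3 × V3)) := by
    by_contra hcon
    push Not at hcon
    have h1 := Submodule.finrank_mono (show W ≤ _ from hcon)
    have h2 := finrank_span_le_card (R := ℂ) ({(h, (0 : V3)), ((0 : V3), k)} : Set (V3 × V3))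
    have h3 : ({(h, (0 : V3)), ((0 : V3), k)} : Set (V3 × V3)).toFinset.card ≤ 2 := by
      rw [Set.toFinset_insert, Set.toFinset_singleton]
      exact Finset.card_le_two
    have := hW.1
    omega
  obtain ⟨⟨q1, q2⟩, hqW, hqn⟩ := hex
  refine ⟨h, q1, q2, hh0, hh, hqW, ?_, ?_⟩
  · rintro c rfl
    have : ((0 : V3), q2) ∈ W := by
      have := W.sub_mem hqW (W.smul_mem c hh)
      simpa using this
    obtain ⟨d, rfl⟩ := hz2 _ this
    apply hqn
    rw [Submodule.mem_span_pair]
    exact ⟨c, d, by simp⟩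
  · rintro c rfl
    have : (q1, (0 : V3)) ∈ W := by
      have := W.sub_mem hqW (W.smul_mem c hk)
      simpa using this
    obtain ⟨d, rfl⟩ := hz1 _ this
    apply hqn
    rw [Submodule.mem_span_pair]
    exact ⟨d, c, by simp⟩

lemma card_rank2 {T : Tri} (hT : Cub T) {a b : ℂ} {e : V3 ≃ₗ[ℂ] V3} (h : NF T a b e) :
    Nat.card {W : Submodule ℂ (V3 × V3) // W ∈ PlS T ∧ ∃ y, y ≠ 0 ∧ ((0 : V3), y) ∈ W} =
      243 := by
  obtain ⟨P, hP1, hP2, hP3⟩ := nine_flexes hT h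
  choose Q hQ0 hQ1 hQ2 hQ3 using fun i => exists_Q hT (hP1 i)
  have hcard : Nat.card (Fin 9 × Fin 9 × {z : ℂ // z ^ 3 = 1}) = 243 := by
    rw [Nat.card_prod, Nat.card_prod, card_roots_one 3 (by norm_num)]
    simp
  have hval : ∀ i (a c : ℂ), T (a • P i + c • Q i) (a • P i + c • Q i) (a • P i + c • Q i)
      = c ^ 3 := by
    intro i a c
    simp only [map_add, map_smul, LinearMap.add_apply, LinearMap.smul_apply, smul_eq_mul,
      hT.s12 (Q i) (P i), hT.s23 _ (Q i) (P i), hQ1, hQ2, hQ3, (hP1 i).2.1]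
    ring
  have hz0 : ∀ z : {z : ℂ // z ^ 3 = 1}, z.1 ≠ 0 := by
    intro z hz
    have := z.2
    rw [hz] at this
    norm_num at this
  rw [← hcard]
  symm
  let f : Fin 9 × Fin 9 × {z : ℂ // z ^ 3 = 1} →
      {W : Submodule ℂ (V3 × V3) // W ∈ PlS T ∧ ∃ y, y ≠ 0 ∧ ((0 : V3), y) ∈ W} :=
    fun t => ⟨LinearMap.range (flMap (P t.1) (Q t.1) (P t.2.1) (t.2.2.1 • Q t.2.1)),
      ⟨finrank_flMap (hP1 _).1 (hQ0 _) (hP1 _).1, by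
        intro z hz
        obtain ⟨x, y, c, h1, h2⟩ := mem_flMap.1 hz
        rw [h1, h2, smul_smul, hval, hval, mul_pow, t.2.2.2, mul_one]⟩,
      P t.2.1, (hP1 _).1, mem_flMap.2 ⟨0, 1, 0, by simp, by simp⟩⟩
  refine Nat.card_congr (Equiv.ofBijective f ⟨?_, ?_⟩)
  · rintro ⟨i, j, z⟩ ⟨i', j', z'⟩ hf
    have hf' : LinearMap.range (flMap (P i) (Q i) (P j) (z.1 • Q j)) =
      LinearMap.range (flMap (P i') (Q i') (P j') (z'.1 • Q j')) := congrArg Subtype.val hf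
    have m1 : (P i, (0 : V3)) ∈ LinearMap.range (flMap (P i) (Q i) (P j) (z.1 • Q j)) :=
      mem_flMap.2 ⟨1, 0, 0, by simp, by simp⟩
    have m2 : ((0 : V3), P j) ∈ LinearMap.range (flMap (P i) (Q i) (P j) (z.1 • Q j)) :=
      mem_flMap.2 ⟨0, 1, 0, by simp, by simp⟩
    have m3 : (Q i, z.1 • Q j) ∈ LinearMap.range (flMap (P i) (Q i) (P j) (z.1 • Q j)) :=
      mem_flMap.2 ⟨0, 0, 1, by simp, by simp⟩
    rw [hf', mem_flMap] at m1 m2 m3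
    obtain ⟨x, y, c, h1, h2⟩ := m1
    have hii : i = i' := by
      simp only [smul_smul] at h2
      have := (pair_indep (hP1 j').1 (hQ0 j') h2.symm).2
      have hc : c = 0 := by simpa [hz0 z'] using this
      simp only [hc, zero_smul, add_zero] at h1
      exact hP2 _ _ _ h1
    obtain ⟨x', y', c', h3, h4⟩ := m2
    have hjj : j = j' := by
      have hc : c' = 0 := (pair_indep (hP1 i').1 (hQ0 i') h3.symm).2
      simp only [hc, zero_smul, add_zero] at h4
      exact hP2 _ _ _ h4
    subst hii hjj
    obtain ⟨x3, y3, c3, h5, h6⟩ := m3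
    have hc : c3 = 1 := by
      have h7 : x3 • P i + (c3 - 1) • Q i = 0 := by
        simp only at h5
        rw [sub_smul, one_smul, ← add_sub_assoc, ← h5, sub_self]
      have := (pair_indep (hP1 i).1 (hQ0 i) h7).2
      linear_combination this
    have hzz : z = z' := by
      apply Subtype.ext
      have h7 : y3 • P j + (z'.1 - z.1) • Q j = 0 := by
        simp only [hc, one_smul] at h6
        rw [sub_smul, ← add_sub_assoc, ← h6, sub_self]
      have := (pair_indep (hP1 j).1 (hQ0 j) h7).2
      linear_combination -this
    rw [hzz]
  · rintro ⟨W, hW, k, hk0, hk⟩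
    obtain ⟨p, q1, q2, hp0, hp, hq, hq1, hq2⟩ := rank2_class hT hW hk0 hk
    have hpf : Flex T p := by
      refine ⟨hp0, ?_, q1, hq1, ?_, ?_⟩
      · simpa using PlS.pol hT hW hp hp hp
      · simpa using PlS.pol hT hW hp hp hq
      · simpa using PlS.pol hT hW hp hq hq
    have hkf : Flex T k := by
      refine ⟨hk0, ?_, q2, hq2, ?_, ?_⟩
      · simpa using (PlS.pol hT hW hk hk hk).symm
      · simpa using (PlS.pol hT hW hk hk hq).symm
      · simpa using (PlS.pol hT hW hk hq hq).symm
    obtain ⟨i, c, hc, rfl⟩ := hP3 p hpf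
    obtain ⟨j, d, hd, rfl⟩ := hP3 k hkf
    have hpi : (P i, (0 : V3)) ∈ W := by
      have := W.smul_mem c⁻¹ hp
      simpa [smul_smul, hc] using this
    have hpj : ((0 : V3), P j) ∈ W := by
      have := W.smul_mem d⁻¹ hk
      simpa [smul_smul, hd] using this
    obtain ⟨α, β, rfl⟩ := tangent_span hT (hP1 i).1 (hP1 i).2.1 (hQ0 i) (hQ1 i) (x := q1)
      (by simpa using PlS.pol hT hW hpi hpi hq)
    obtain ⟨γ, δ, rfl⟩ := tangent_span hT (hP1 j).1 (hP1 j).2.1 (hQ0 j) (hQ1 j) (x := q2)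
      (by simpa using (PlS.pol hT hW hpj hpj hq).symm)
    have hβδ : β ^ 3 = δ ^ 3 := by
      have := hW.2 _ hq
      simpa only [hval] using this
    have hβ : β ≠ 0 := by
      rintro rfl
      apply hq1 (α * c⁻¹)
      rw [smul_smul, mul_assoc, inv_mul_cancel₀ hc]
      simp
    have hz : (δ / β) ^ 3 = 1 := by
      rw [div_pow, hβδ, div_self]
      rw [← hβδ]
      exact pow_ne_zero _ hβ
    have hqq : (Q i, (δ / β) • Q j) ∈ W := by
      have := W.smul_mem β⁻¹ (W.sub_mem (W.sub_mem hq (W.smul_mem α hpi)) (W.smul_mem γ hpj))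
      convert this using 1
      ext1
      · simp [smul_smul, hβ]
      · simp [smul_smul]
        congr 1
        field_simp
    refine ⟨(i, j, ⟨δ / β, hz⟩), ?_⟩
    apply Subtype.ext
    show LinearMap.range (flMap (P i) (Q i) (P j) ((δ / β) • Q j)) = W
    apply Submodule.eq_of_le_of_finrank_eq
    · intro z hzm
      obtain ⟨x, y, s, h1, h2⟩ := mem_flMap.1 hzm
      have := W.add_mem (W.add_mem (W.smul_mem x hpi) (W.smul_mem y hpj)) (W.smul_mem s hqq)
      convert this using 1
      ext1
      · simp [h1]
      · simp [h2]
    · rw [finrank_flMap (hP1 _).1 (hQ0 _) (hP1 _).1, hW.1]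

lemma ncard_PlS {T : Tri} (hT : Cub T) {a b : ℂ} {e : V3 ≃ₗ[ℂ] V3} (h : NF T a b e)
    (hfin : Nat.card {σ : V3 ≃ₗ[ℂ] V3 // IsAut T σ} ≠ 0) :
    (PlS T).ncard = 243 + Nat.card {σ : V3 ≃ₗ[ℂ] V3 // IsAut T σ} := by
  have hU : PlS T = {W | W ∈ PlS T ∧ ∃ y, y ≠ 0 ∧ ((0 : V3), y) ∈ W} ∪
      {W | W ∈ PlS T ∧ ∀ y, ((0 : V3), y) ∈ W → y = 0} := by
    ext W
    simp only [Set.mem_union, Set.mem_ofPred_eq, ← and_or_left]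
    refine ⟨fun hW => ⟨hW, ?_⟩, fun hW => hW.1⟩
    by_contra hcon
    push Not at hcon
    obtain ⟨h1, y, h2, h3⟩ := hcon
    exact h1 y h3 h2
  have hB := card_rank2 hT h
  have hA := card_graphs hT
  have fB : {W | W ∈ PlS T ∧ ∃ y, y ≠ 0 ∧ ((0 : V3), y) ∈ W}.Finite :=
    Nat.finite_of_card_ne_zero (ne_of_eq_of_ne hB (by norm_num))
  have fA : {W | W ∈ PlS T ∧ ∀ y, ((0 : V3), y) ∈ W → y = 0}.Finite :=
    Nat.finite_of_card_ne_zero (ne_of_eq_of_ne hA hfin)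
  rw [hU, Set.ncard_union_eq ?_ fB fA]
  · exact congrArg₂ (· + ·) hB hA
  · rw [Set.disjoint_left]
    rintro W ⟨_, y, hy0, hy⟩ ⟨_, hc⟩
    exact hy0 (hc y hy)

/-- Splitting of coordinates. -/
def split6 : (Fin 6 → ℂ) ≃ₗ[ℂ] V3 × V3 where
  toFun v := (![v 0, v 1, v 2], ![v 3, v 4, v 5])
  map_add' u v := by
    ext i <;> fin_cases i <;> simp
  map_smul' c v := by
    ext i <;> fin_cases i <;> simp
  invFun z := ![z.1 0, z.1 1, z.1 2, z.2 0, z.2 1, z.2 2]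
  left_inv v := by
    funext i; fin_cases i <;> rfl
  right_inv z := by
    ext i <;> fin_cases i <;> rfl

lemma eval_hyper (F : MvPolynomial (Fin 3) ℂ) (v : Fin 6 → ℂ) :
    eval v (hyperPoly F F) = eval (split6 v).1 F - eval (split6 v).2 F := by
  have h1 : v ∘ (![0, 1, 2] : Fin 3 → Fin 6) = (split6 v).1 := by
    funext i; fin_cases i <;> rfl
  have h2 : v ∘ (![3, 4, 5] : Fin 3 → Fin 6) = (split6 v).2 := by
    funext i; fin_cases i <;> rfl
  rw [hyperPoly, map_sub, eval_rename, eval_rename, h1, h2]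

lemma ncard_planes (F : MvPolynomial (Fin 3) ℂ) (hF : F.IsHomogeneous 3) :
    (planesIn (hyperPoly F F)).ncard = (PlS (polT F)).ncard := by
  have : PlS (polT F) = 
      Set.image (Submodule.map split6.toLinearMap) (planesIn (hyperPoly F F)) := by
    ext W
    constructor
    · intro hW
      refine ⟨W.map split6.symm.toLinearMap, ⟨?_, ?_⟩, ?_⟩
      · rw [LinearEquiv.finrank_map_eq]; exact hW.1
      · rintro _ ⟨z, hz, rfl⟩
        rw [eval_hyper]
        simp only [LinearEquiv.coe_coe, LinearEquiv.apply_symm_apply]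
        rw [polT_eval F hF, polT_eval F hF, hW.2 z hz, sub_self]
      · rw [← Submodule.map_comp]
        simp
    · rintro ⟨U, hU, rfl⟩
      refine ⟨?_, ?_⟩
      · rw [LinearEquiv.finrank_map_eq]; exact hU.1
      · rintro _ ⟨z, hz, rfl⟩
        have := hU.2 z hz
        rw [eval_hyper, polT_eval F hF, polT_eval F hF, sub_eq_zero] at this
        exact this
  rw [this, Set.ncard_image_of_injective]
  exact Submodule.map_injective_of_injective split6.injective


lemma eval_applyMat (g : Matrix (Fin 3) (Fin 3) ℂ) (F : MvPolynomial (Fin 3) ℂ) (v : V3) :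
    eval v (applyMat g F) = eval (g.mulVec v) F := by
  rw [applyMat, aeval_def, ← eval₂_id, ← eval₂_id]
  have := eval₂_comp_left (eval v) (algebraMap ℂ (MvPolynomial (Fin 3) ℂ))
    (fun i => ∑ j, C (g i j) * X j) F
  rw [eval₂_id, this]
  have h1 : (eval v).comp (algebraMap ℂ (MvPolynomial (Fin 3) ℂ)) = RingHom.id ℂ := by
    ext x; simp [algebraMap_eq]
  rw [h1]
  congr 1
  funext i
  simp [Matrix.mulVec, dotProduct]

lemma card_GL (F : MvPolynomial (Fin 3) ℂ) (hF : F.IsHomogeneous 3) (hT : Cub (polT F)) :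
    Nat.card {g : GL (Fin 3) ℂ // applyMat g.val F = F} =
      Nat.card {σ : V3 ≃ₗ[ℂ] V3 // IsAut (polT F) σ} := by
  refine Nat.card_congr (Equiv.subtypeEquiv
    ((Matrix.GeneralLinearGroup.toLin.trans
      (LinearMap.GeneralLinearGroup.generalLinearEquiv ℂ V3)).toEquiv) ?_)
  intro g
  rw [isAut_iff hT]
  have key : ∀ v, ((Matrix.GeneralLinearGroup.toLin.trans
      (LinearMap.GeneralLinearGroup.generalLinearEquiv ℂ V3)).toEquiv g) v = g.val.mulVec v := by
    intro v; rfl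
  constructor
  · intro h v
    rw [key, ← polT_eval F hF, ← polT_eval F hF, ← eval_applyMat, h]
  · intro h
    apply MvPolynomial.funext
    intro v
    rw [eval_applyMat, polT_eval F hF, polT_eval F hF, ← h v, key]

lemma wT_polarize (a b : ℂ) (u v w : V3) :
    wT a b u v w = (wT a b (u + v + w) (u + v + w) (u + v + w) - wT a b (u + v) (u + v) (u + v)
      - wT a b (u + w) (u + w) (u + w) - wT a b (v + w) (v + w) (v + w)
      + wT a b u u u + wT a b v v v + wT a b w w w) / 6 := by
  simp only [wT, Pi.add_apply]
  ring

lemma NF_of_diag {T : Tri} (hT : Cub T) {a b : ℂ} {e : V3 ≃ₗ[ℂ] V3}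
    (h : ∀ v, T (e v) (e v) (e v) = wT a b v v v) : NF T a b e := by
  intro u v w
  rw [polarize hT, wT_polarize]
  simp only [← map_add, h]

lemma eval_wPoly (E : WeierstrassCurve ℂ) (v : V3) : eval v (wPoly E) =
    v 1 ^ 2 * v 2 + E.a₁ * (v 0 * v 1 * v 2) + E.a₃ * (v 1 * v 2 ^ 2)
    - (v 0 ^ 3 + E.a₂ * (v 0 ^ 2 * v 2) + E.a₄ * (v 0 * v 2 ^ 2) + E.a₆ * v 2 ^ 3) := by
  simp [wPoly]

/-- Completing the square and the cube. -/
def shortE (r s t : ℂ) : V3 ≃ₗ[ℂ] V3 where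
  toFun v := ![v 0 + r * v 2, v 1 + s * v 0 + t * v 2, v 2]
  map_add' u v := by
    ext i; fin_cases i <;> simp <;> ring
  map_smul' c v := by
    ext i; fin_cases i <;> simp <;> ring
  invFun v := ![v 0 - r * v 2, v 1 - s * (v 0 - r * v 2) - t * v 2, v 2]
  left_inv v := by
    funext i; fin_cases i <;> simp <;> ring
  right_inv v := by
    funext i; fin_cases i <;> simp <;> ring

lemma NF_of_E (F : MvPolynomial (Fin 3) ℂ) (hF : F.IsHomogeneous 3) (hT : Cub (polT F))
    (E : WeierstrassCurve ℂ) (g : Matrix (Fin 3) (Fin 3) ℂ) (hg : IsUnit g.det)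
    (h : applyMat g F = wPoly E) :
    ∃ e, NF (polT F) (-E.c₄ / 48) (-E.c₆ / 864) e := by
  let G : V3 ≃ₗ[ℂ] V3 := Matrix.toLinearEquiv' g ((Matrix.isUnit_iff_isUnit_det g).2 hg).invertible
  have hG : ∀ v, G v = g.mulVec v := by
    intro v
    exact Matrix.toLin'_apply g v
  refine ⟨(shortE (-E.b₂ / 12) (-E.a₁ / 2) (E.a₁ * E.b₂ / 24 - E.a₃ / 2)).trans G,
    NF_of_diag hT ?_⟩
  intro v
  rw [LinearEquiv.trans_apply, hG, ← polT_eval F hF, ← eval_applyMat, h, eval_wPoly]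
  simp [shortE, wT, WeierstrassCurve.c₄, WeierstrassCurve.c₆, WeierstrassCurve.b₂,
    WeierstrassCurve.b₄, WeierstrassCurve.b₆]
  ring

lemma hasJ_of_NF (F : MvPolynomial (Fin 3) ℂ) (hF : F.IsHomogeneous 3) (hT : Cub (polT F))
    {a b : ℂ} {e : V3 ≃ₗ[ℂ] V3} (h : NF (polT F) a b e) :
    HasJInvariant F (1728 * (4 * a ^ 3) / (4 * a ^ 3 + 27 * b ^ 2)) := by
  have hd := NF.disc hT h
  have hΔ : (WeierstrassCurve.mk 0 0 0 a b : WeierstrassCurve ℂ).Δ =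
      -16 * (4 * a ^ 3 + 27 * b ^ 2) := by
    simp [WeierstrassCurve.Δ, WeierstrassCurve.b₂, WeierstrassCurve.b₄, WeierstrassCurve.b₆,
      WeierstrassCurve.b₈]
    ring
  refine ⟨WeierstrassCurve.mk 0 0 0 a b, ⟨?_⟩, ?_, LinearMap.toMatrix' e.toLinearMap, ?_, ?_⟩
  · rw [hΔ]
    exact IsUnit.mk0 _ (mul_ne_zero (by norm_num) hd)
  · rw [WeierstrassCurve.j, Units.val_inv_eq_inv_val, WeierstrassCurve.coe_Δ', hΔ]
    simp [WeierstrassCurve.c₄, WeierstrassCurve.b₂, WeierstrassCurve.b₄]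
    field_simp
    ring
  · rw [← LinearMap.det_toLin', Matrix.toLin'_toMatrix']
    exact LinearEquiv.isUnit_det' e
  · apply MvPolynomial.funext
    intro v
    rw [eval_applyMat, LinearMap.toMatrix'_mulVec, eval_wPoly, polT_eval F hF]
    rw [LinearEquiv.coe_coe, h]
    simp [wT]
    ring

/-- For a ternary cubic form `F` defining a smooth plane cubic, the cubic
fourfold `X : F(x) = F(y)` contains exactly `243 + |Aut(F)|` planes, which is `405` if the
elliptic curve `F = 0` has j-invariant `0`, `351` if `j = 1728`, and `297` otherwise. -/
theorem stmt_13 (F : MvPolynomial (Fin 3) ℂ) (hF : F.IsHomogeneous 3)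
    (hsmooth : ∀ v : Fin 3 → ℂ, v ≠ 0 →
      ¬ (eval v F = 0 ∧ ∀ i, eval v (pderiv i F) = 0)) :
    (planesIn (hyperPoly F F)).ncard
        = 243 + Nat.card {g : GL (Fin 3) ℂ // applyMat g.val F = F} ∧
      (HasJInvariant F 0 → (planesIn (hyperPoly F F)).ncard = 405) ∧
      (HasJInvariant F 1728 → (planesIn (hyperPoly F F)).ncard = 351) ∧
      (¬ HasJInvariant F 0 → ¬ HasJInvariant F 1728 →
        (planesIn (hyperPoly F F)).ncard = 297) := by
  have hT := polT_cub F hF hsmooth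
  obtain ⟨p, hp⟩ := exists_flex hT F (polT_eval F hF)
  obtain ⟨a, b, e, hN, -⟩ := exists_NF hT hp
  have hZ : Nat.card (Zset a b) ≠ 0 := by
    have hd := NF.disc hT hN
    by_cases ha : a = 0
    · have hb : b ≠ 0 := by rintro rfl; simp [ha] at hd
      rw [card_Z_0 a b ha hb]; norm_num
    · by_cases hb : b = 0
      · rw [card_Z_1728 a b ha hb]; norm_num
      · rw [card_Z_gen a b ha hb]; norm_num
  have hfin : Nat.card {σ : V3 ≃ₗ[ℂ] V3 // IsAut (polT F) σ} ≠ 0 := by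
    rw [card_aut hT hN]
    exact mul_ne_zero (by norm_num) hZ
  have hmain : (planesIn (hyperPoly F F)).ncard =
      243 + Nat.card {σ : V3 ≃ₗ[ℂ] V3 // IsAut (polT F) σ} := by
    rw [ncard_planes F hF, ncard_PlS hT hN hfin]
  refine ⟨by rw [hmain, card_GL F hF hT], ?_, ?_, ?_⟩
  · rintro ⟨E, hE, hj, g, hg, hgF⟩
    obtain ⟨e', h'⟩ := NF_of_E F hF hT E g hg hgF
    have hd := NF.disc hT h'
    have hc : E.c₄ = 0 := by
      rw [WeierstrassCurve.j] at hj
      have hΔ : E.Δ ≠ 0 := hE.isUnit.ne_zero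
      simpa [hΔ] using hj
    have hb : -E.c₆ / 864 ≠ 0 := by
      intro hb
      rw [hb, hc] at hd
      simp at hd
    rw [hmain, card_aut hT h', card_Z_0 _ _ (by rw [hc]; simp) hb]
  · rintro ⟨E, hE, hj, g, hg, hgF⟩
    obtain ⟨e', h'⟩ := NF_of_E F hF hT E g hg hgF
    have hd := NF.disc hT h'
    have hc : E.c₆ = 0 := by
      have hΔ : E.Δ ≠ 0 := hE.isUnit.ne_zero
      rw [WeierstrassCurve.j, Units.val_inv_eq_inv_val, WeierstrassCurve.coe_Δ',
        inv_mul_eq_iff_eq_mul₀ hΔ] at hj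
      have := E.c_relation
      have h2 : E.c₆ ^ 2 = 0 := by linear_combination hj + this
      exact pow_eq_zero_iff (two_ne_zero) |>.1 h2
    have ha : -E.c₄ / 48 ≠ 0 := by
      intro ha
      rw [ha, hc] at hd
      simp at hd
    rw [hmain, card_aut hT h', card_Z_1728 _ _ ha (by rw [hc]; simp)]
  · intro h0 h1
    have hJ := hasJ_of_NF F hF hT hN
    have hd := NF.disc hT hN
    have ha : a ≠ 0 := by
      rintro rfl
      apply h0
      simpa using hJ
    have hb : b ≠ 0 := by
      rintro rfl
      apply h1
      convert hJ using 1
      field_simp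
      simp
    rw [hmain, card_aut hT hN, card_Z_gen a b ha hb]


end
end
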